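/- arXiv:1701.02234 — 4 statements merged into one kernel-verified Lean document; each statement's English description precedes it below -/
import Mathlib

section
/- Let (X_n)_{n≥1} be a sequence of pairwise independent, integrable real-valued random variables and set G(x) = sup_{n≥1} P(|X_n| > x) for x ≥ 0. If ∫_0^∞ G(x) dx < ∞, then for every bounded sequence of real numbers (c_n), (1/n) ∑_{k=1}^{n} c_k (X_k − E X_k) → 0 almost surely as n → ∞. -/
open MeasureTheory ProbabilityTheory Filter ENNReal

theorem Antitone.tsum_succ_le_lintegral_Ioi {G : ℝ → ℝ≥0∞} (hG : Antitone G) :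
    ∑' j : ℕ, G (j + 1) ≤ ∫⁻ x in Set.Ioi (0 : ℝ), G x := by
  have hdisj : Pairwise (Function.onFun Disjoint fun j : ℕ => Set.Ioc (j : ℝ) ((j + 1 : ℕ) : ℝ)) :=
    Nat.mono_cast.pairwise_disjoint_on_Ioc_succ
  calc
    ∑' j : ℕ, G (j + 1) ≤ ∑' j : ℕ, ∫⁻ x in Set.Ioc (j : ℝ) ((j + 1 : ℕ) : ℝ), G x := by
      refine ENNReal.tsum_le_tsum fun j => ?_
      calc
        G (j + 1) = ∫⁻ _ in Set.Ioc (j : ℝ) ((j + 1 : ℕ) : ℝ), G (j + 1) := by simp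
        _ ≤ ∫⁻ x in Set.Ioc (j : ℝ) ((j + 1 : ℕ) : ℝ), G x :=
          setLIntegral_mono hG.measurable fun x hx => hG (by simpa using hx.2)
    _ = ∫⁻ x in ⋃ j : ℕ, Set.Ioc (j : ℝ) ((j + 1 : ℕ) : ℝ), G x :=
      (lintegral_iUnion (fun _ => measurableSet_Ioc) hdisj _).symm
    _ ≤ ∫⁻ x in Set.Ioi (0 : ℝ), G x :=
      lintegral_mono_set (Set.iUnion_subset fun j x hx => (Nat.cast_nonneg j).trans_lt hx.1)

/-- Integrable antitone functions on the half-line vanish at infinity. -/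
theorem Antitone.tendsto_zero_of_lintegral_Ioi_lt_top {G : ℝ → ℝ≥0∞} (hG : Antitone G)
    (hfin : ∫⁻ x in Set.Ioi (0 : ℝ), G x < ∞) :
    Tendsto (fun j : ℕ => G j) atTop (nhds 0) := by
  rw [← tendsto_add_atTop_iff_nat 1]
  simpa using ENNReal.tendsto_atTop_zero_of_tsum_ne_top
    (hG.tsum_succ_le_lintegral_Ioi.trans_lt hfin).ne

theorem Antitone.tendsto_lintegral_Ioi_add_zero {G : ℝ → ℝ≥0∞} (hG : Antitone G)
    (hfin : ∫⁻ x in Set.Ioi (0 : ℝ), G x < ∞) :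
    Tendsto (fun j : ℕ => ∫⁻ x in Set.Ioi (0 : ℝ), G (x + j)) atTop (nhds 0) := by
  have h := tendsto_lintegral_of_dominated_convergence (μ := volume.restrict (Set.Ioi (0 : ℝ)))
    (F := fun (j : ℕ) x => G (x + j)) (f := fun _ => 0) G
    (fun j => hG.measurable.comp (measurable_id.add_const _))
    (fun j => Eventually.of_forall fun x => hG (by simp)) hfin.ne ?_
  · simpa using h
  · filter_upwards [ae_restrict_mem measurableSet_Ioi] with x hx
    exact tendsto_of_tendsto_of_tendsto_of_le_of_le tendsto_const_nhds
      (hG.tendsto_zero_of_lintegral_Ioi_lt_top hfin) (fun _ => zero_le)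
      (fun j => hG (le_add_of_nonneg_left (le_of_lt hx)))

theorem sum_inv_sq_filter_lt_mul_le {x : ℝ} (hx : 0 < x) (K : ℕ) :
    (∑ j ∈ Finset.range K with x < (j : ℕ), ((j : ℝ) ^ 2)⁻¹) * x ≤ 2 := by
  have h : (∑ j ∈ Finset.range K with x < (j : ℕ), ((j : ℝ) ^ 2)⁻¹) ≤
      2 / ((⌊x⌋₊ : ℝ) + 1) := by
    refine le_trans (le_of_eq ?_) (sum_Ioo_inv_sq_le ⌊x⌋₊ K)
    congr 1
    ext j
    simp [Nat.floor_lt hx.le, and_comm]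
  calc
    _ ≤ 2 / ((⌊x⌋₊ : ℝ) + 1) * x := by gcongr
    _ ≤ 2 / x * x := by gcongr; exact (Nat.lt_floor_add_one x).le
    _ = 2 := div_mul_cancel₀ _ hx.ne'

section

variable {Ω : Type*} [MeasurableSpace Ω] {μ : Measure Ω}

theorem lintegral_ofReal_min_sq_le {Z : Ω → ℝ} (hZ : Measurable Z) (hnonneg : ∀ ω, 0 ≤ Z ω)
    {G : ℝ → ℝ≥0∞} (htail : ∀ x, 0 ≤ x → μ {ω | x < Z ω} ≤ G x) {a : ℝ} (ha : 0 ≤ a) :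
    ∫⁻ ω, ENNReal.ofReal (min (Z ω) a ^ 2) ∂μ ≤
      2 * ∫⁻ x in Set.Ioi (0 : ℝ), if x < a then G x * ENNReal.ofReal x else 0 := by
  have h := lintegral_rpow_eq_lintegral_meas_lt_mul μ (f := fun ω => min (Z ω) a)
    (Eventually.of_forall fun ω => le_min (hnonneg ω) ha)
    (hZ.min measurable_const).aemeasurable two_pos
  simp only [Real.rpow_two] at h
  rw [h, ENNReal.ofReal_ofNat]
  gcongr 2 * ?_
  refine setLIntegral_mono' measurableSet_Ioi fun x hx => ?_
  split_ifs with hxa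
  · norm_num
    gcongr
    simpa [hxa] using htail x (le_of_lt hx)
  · simp [hxa]

theorem sum_inv_sq_mul_variance_min_le [IsProbabilityMeasure μ] {Z : ℕ → Ω → ℝ}
    (hZ : ∀ k, Measurable (Z k)) (hnonneg : ∀ k ω, 0 ≤ Z k ω)
    {G : ℝ → ℝ≥0∞} (hG : Antitone G) (hfin : ∫⁻ x in Set.Ioi (0 : ℝ), G x < ∞)
    (htail : ∀ k x, 0 ≤ x → μ {ω | x < Z k ω} ≤ G x) (K : ℕ) :
    ∑ j ∈ Finset.range K, ((j : ℝ) ^ 2)⁻¹ * variance (fun ω => min (Z j ω) j) μ ≤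
      (4 * ∫⁻ x in Set.Ioi (0 : ℝ), G x).toReal := by
  have hmeas : ∀ j : ℕ, Measurable fun ω => min (Z j ω) (j : ℝ) := fun j =>
    (hZ j).min measurable_const
  rw [← ENNReal.ofReal_le_iff_le_toReal (ENNReal.mul_lt_top (by simp) hfin).ne]
  have hvar : ∀ j : ℕ, ENNReal.ofReal (((j : ℝ) ^ 2)⁻¹ * variance (fun ω => min (Z j ω) j) μ) ≤
      ENNReal.ofReal (((j : ℝ) ^ 2)⁻¹) *
        (2 * ∫⁻ x in Set.Ioi (0 : ℝ), if x < j then G x * ENNReal.ofReal x else 0) := fun j => by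
    rw [ENNReal.ofReal_mul (by positivity)]
    gcongr
    refine le_trans ?_ (lintegral_ofReal_min_sq_le (hZ j) (hnonneg j) (htail j) j.cast_nonneg)
    refine (ENNReal.ofReal_le_ofReal
      (variance_le_expectation_sq (hmeas j).aestronglyMeasurable)).trans ?_
    simp only [Pi.pow_apply]
    rw [integral_eq_lintegral_of_nonneg_ae (Eventually.of_forall fun ω => sq_nonneg _)
      ((hmeas j).pow_const 2).aestronglyMeasurable]
    exact ENNReal.ofReal_toReal_le
  have hterm : ∀ j : ℕ, Measurable fun x : ℝ => if x < j then G x * ENNReal.ofReal x else 0 :=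
    fun j => Measurable.ite measurableSet_Iio (hG.measurable.mul ENNReal.measurable_ofReal)
      measurable_const
  calc
    _ ≤ ∑ j ∈ Finset.range K, ENNReal.ofReal (((j : ℝ) ^ 2)⁻¹) *
        (2 * ∫⁻ x in Set.Ioi (0 : ℝ), if x < j then G x * ENNReal.ofReal x else 0) := by
      rw [ENNReal.ofReal_sum_of_nonneg fun j _ => mul_nonneg (by positivity) (variance_nonneg _ _)]
      exact Finset.sum_le_sum fun j _ => hvar j
    _ = 2 * ∫⁻ x in Set.Ioi (0 : ℝ), ∑ j ∈ Finset.range K,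
        ENNReal.ofReal (((j : ℝ) ^ 2)⁻¹) * if x < j then G x * ENNReal.ofReal x else 0 := by
      rw [lintegral_finsetSum _ fun j _ => (hterm j).const_mul _, Finset.mul_sum]
      refine Finset.sum_congr rfl fun j _ => ?_
      rw [lintegral_const_mul _ (hterm j)]
      ring
    _ ≤ 2 * ∫⁻ x in Set.Ioi (0 : ℝ), 2 * G x := by
      gcongr 2 * ?_
      refine setLIntegral_mono' measurableSet_Ioi fun x hx => ?_
      calc
        _ = ENNReal.ofReal ((∑ j ∈ Finset.range K with x < (j : ℕ), ((j : ℝ) ^ 2)⁻¹) * x) *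
            G x := by
          rw [ENNReal.ofReal_mul (Finset.sum_nonneg fun j _ => by positivity),
            ENNReal.ofReal_sum_of_nonneg fun j _ => by positivity, Finset.sum_filter,
            Finset.sum_mul, Finset.sum_mul]
          refine Finset.sum_congr rfl fun j _ => ?_
          split_ifs <;> ring
        _ ≤ 2 * G x := by
          gcongr
          simpa using ENNReal.ofReal_le_ofReal (sum_inv_sq_filter_lt_mul_le hx K)
    _ = 4 * ∫⁻ x in Set.Ioi (0 : ℝ), G x := by
      rw [lintegral_const_mul _ hG.measurable, ← mul_assoc]
      norm_num

/-- Chebyshev's inequality and Borel-Cantelli along a geometric sequence. -/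
theorem ae_eventually_abs_sum_sub_lt_floor_pow [IsProbabilityMeasure μ] {Y : ℕ → Ω → ℝ}
    (hY : ∀ k, MemLp (Y k) 2 μ) (hindep : Pairwise fun i j => IndepFun (Y i) (Y j) μ)
    (hzero : Y 0 = 0) {B : ℝ}
    (hB : ∀ K, ∑ j ∈ Finset.range K, ((j : ℝ) ^ 2)⁻¹ * variance (Y j) μ ≤ B)
    {c : ℝ} (c_one : 1 < c) {ε : ℝ} (εpos : 0 < ε) :
    ∀ᵐ ω ∂μ, ∀ᶠ n : ℕ in atTop,
      |∑ i ∈ Finset.range ⌊c ^ n⌋₊, (Y i ω - ∫ ω', Y i ω' ∂μ)| < ε * ⌊c ^ n⌋₊ := by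
  have c_pos : 0 < c := zero_lt_one.trans c_one
  set S := fun n => ∑ i ∈ Finset.range n, Y i with hS
  let u : ℕ → ℕ := fun n => ⌊c ^ n⌋₊
  have u_mono : Monotone u := fun i j hij => Nat.floor_mono (pow_right_mono₀ c_one.le hij)
  let C := c ^ 5 * (c - 1)⁻¹ ^ 3 * B
  have hvar : ∀ N, ∑ i ∈ Finset.range N, ((u i : ℝ) ^ 2)⁻¹ * variance (S (u i)) μ ≤ C := by
    intro N
    calc
      ∑ i ∈ Finset.range N, ((u i : ℝ) ^ 2)⁻¹ * variance (S (u i)) μ =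
          ∑ i ∈ Finset.range N, ((u i : ℝ) ^ 2)⁻¹ *
            ∑ j ∈ Finset.range (u i), variance (Y j) μ := by
        congr 1 with i
        congr 1
        rw [hS, IndepFun.variance_sum (fun j _ => hY j) fun k _ l _ hkl => hindep hkl]
      _ = ∑ j ∈ Finset.range (u (N - 1)),
          (∑ i ∈ Finset.range N with j < u i, ((u i : ℝ) ^ 2)⁻¹) * variance (Y j) μ := by
        simp_rw [Finset.mul_sum, Finset.sum_mul, Finset.sum_sigma']
        refine Finset.sum_nbij' (fun p ↦ ⟨p.2, p.1⟩) (fun p ↦ ⟨p.2, p.1⟩) ?_ ?_ ?_ ?_ ?_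
        · simp only [Finset.mem_sigma, Finset.mem_range, Finset.mem_filter, and_imp,
            Sigma.forall]
          exact fun a b haN hb ↦ ⟨hb.trans_le <| u_mono <| Nat.le_pred_of_lt haN, haN, hb⟩
        all_goals simp
      _ ≤ ∑ j ∈ Finset.range (u (N - 1)),
          c ^ 5 * (c - 1)⁻¹ ^ 3 / (j : ℝ) ^ 2 * variance (Y j) μ := by
        gcongr ∑ _ ∈ _, ?_ with j
        rcases eq_zero_or_pos j with (rfl | hj)
        · simp [hzero]
        apply mul_le_mul_of_nonneg_right _ (variance_nonneg _ _)
        convert! sum_div_nat_floor_pow_sq_le_div_sq N (Nat.cast_pos.2 hj) c_one using 2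
        · simp only [u, Nat.cast_lt]
        · simp only [u, one_div]
      _ = c ^ 5 * (c - 1)⁻¹ ^ 3 *
          ∑ j ∈ Finset.range (u (N - 1)), ((j : ℝ) ^ 2)⁻¹ * variance (Y j) μ := by
        simp_rw [Finset.mul_sum, div_eq_mul_inv, mul_assoc]
      _ ≤ C := by
        apply mul_le_mul_of_nonneg_left (hB _)
        apply mul_nonneg (pow_nonneg c_pos.le _)
        exact pow_nonneg (inv_nonneg.2 (sub_nonneg.2 c_one.le)) _
  have hprob : ∀ N, ∑ i ∈ Finset.range N, μ {ω | (u i * ε : ℝ) ≤ |S (u i) ω - μ[S (u i)]|} ≤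
      ENNReal.ofReal (ε⁻¹ ^ 2 * C) := by
    intro N
    calc
      ∑ i ∈ Finset.range N, μ {ω | (u i * ε : ℝ) ≤ |S (u i) ω - μ[S (u i)]|} ≤
          ∑ i ∈ Finset.range N, ENNReal.ofReal (variance (S (u i)) μ / (u i * ε) ^ 2) := by
        gcongr with i _
        apply meas_ge_le_variance_div_sq
        · exact memLp_finsetSum' _ fun j _ => hY j
        · apply mul_pos (Nat.cast_pos.2 _) εpos
          refine zero_lt_one.trans_le ?_
          apply Nat.le_floor
          rw [Nat.cast_one]
          apply one_le_pow₀ c_one.le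
      _ = ENNReal.ofReal (∑ i ∈ Finset.range N, variance (S (u i)) μ / (u i * ε) ^ 2) := by
        rw [ENNReal.ofReal_sum_of_nonneg fun i _ => ?_]
        exact div_nonneg (variance_nonneg _ _) (sq_nonneg _)
      _ ≤ ENNReal.ofReal (ε⁻¹ ^ 2 * C) := by
        apply ENNReal.ofReal_le_ofReal
        simp_rw [div_eq_inv_mul, ← inv_pow, mul_inv, mul_comm _ (ε⁻¹), mul_pow, mul_assoc,
          ← Finset.mul_sum]
        gcongr
        simpa only [inv_pow] using hvar N
  have hsum : (∑' i, μ {ω | (u i * ε : ℝ) ≤ |S (u i) ω - μ[S (u i)]|}) < ∞ :=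
    (le_of_tendsto_of_tendsto' (ENNReal.tendsto_nat_tsum _) tendsto_const_nhds hprob).trans_lt
      ENNReal.ofReal_lt_top
  filter_upwards [ae_eventually_notMem hsum.ne] with ω hω
  filter_upwards [hω] with n hn
  have hexp : μ[S (u n)] = ∑ i ∈ Finset.range (u n), ∫ ω', Y i ω' ∂μ := by
    simp only [hS, Finset.sum_apply]
    exact integral_finsetSum _ fun i _ => (hY i).integrable one_le_two
  simp only [not_le, hexp] at hn
  simpa [hS, Finset.sum_apply, ← Finset.sum_sub_distrib, mul_comm] using hn

theorem ae_tendsto_sum_sub_div_floor_pow [IsProbabilityMeasure μ] {Y : ℕ → Ω → ℝ}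
    (hY : ∀ k, MemLp (Y k) 2 μ) (hindep : Pairwise fun i j => IndepFun (Y i) (Y j) μ)
    (hzero : Y 0 = 0) {B : ℝ}
    (hB : ∀ K, ∑ j ∈ Finset.range K, ((j : ℝ) ^ 2)⁻¹ * variance (Y j) μ ≤ B)
    {c : ℝ} (c_one : 1 < c) :
    ∀ᵐ ω ∂μ, Tendsto (fun n : ℕ =>
      (∑ i ∈ Finset.range ⌊c ^ n⌋₊, (Y i ω - ∫ ω', Y i ω' ∂μ)) / ⌊c ^ n⌋₊) atTop (nhds 0) := by
  obtain ⟨v, -, v_pos, v_lim⟩ :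
      ∃ v : ℕ → ℝ, StrictAnti v ∧ (∀ n : ℕ, 0 < v n) ∧ Tendsto v atTop (nhds 0) :=
    exists_seq_strictAnti_tendsto (0 : ℝ)
  have := fun i => ae_eventually_abs_sum_sub_lt_floor_pow hY hindep hzero hB c_one (v_pos i)
  filter_upwards [ae_all_iff.2 this] with ω hω
  rw [Metric.tendsto_nhds]
  intro ε εpos
  obtain ⟨i, hi⟩ : ∃ i, v i < ε := ((tendsto_order.1 v_lim).2 ε εpos).exists
  filter_upwards [hω i] with n hn
  have hpos : (0 : ℝ) < ⌊c ^ n⌋₊ := by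
    exact_mod_cast Nat.floor_pos.2 (one_le_pow₀ c_one.le)
  rw [Real.dist_eq, sub_zero, abs_div, Nat.abs_cast, div_lt_iff₀ hpos]
  exact hn.trans_le (by gcongr)

/-- Strong law of large numbers for pairwise independent nonnegative random variables whose tails
are uniformly dominated by an integrable function. -/
theorem ae_tendsto_sum_sub_integral_div_of_nonneg [IsProbabilityMeasure μ] {Z : ℕ → Ω → ℝ}
    (hZ : ∀ k, Measurable (Z k)) (hnonneg : ∀ k ω, 0 ≤ Z k ω)
    (hindep : Pairwise fun i j => IndepFun (Z i) (Z j) μ)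
    {G : ℝ → ℝ≥0∞} (hG : Antitone G) (hfin : ∫⁻ x in Set.Ioi (0 : ℝ), G x < ∞)
    (htail : ∀ k x, 0 ≤ x → μ {ω | x < Z k ω} ≤ G x) :
    ∀ᵐ ω ∂μ, Tendsto (fun n : ℕ =>
      (∑ i ∈ Finset.range n, (Z i ω - ∫ ω', Z i ω' ∂μ)) / n) atTop (nhds 0) := by
  set Y : ℕ → Ω → ℝ := fun k ω => min (Z k ω) k
  have hYm : ∀ k, Measurable (Y k) := fun k => (hZ k).min measurable_const
  have hY_nonneg : ∀ k ω, 0 ≤ Y k ω := fun k ω => le_min (hnonneg k ω) k.cast_nonneg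
  have hY : ∀ k, MemLp (Y k) 2 μ := fun k =>
    MemLp.of_bound (hYm k).aestronglyMeasurable k (Eventually.of_forall fun ω => by
      rw [Real.norm_of_nonneg (hY_nonneg k ω)]
      exact min_le_right _ _)
  have hYindep : Pairwise fun i j => IndepFun (Y i) (Y j) μ := fun i j hij =>
    (hindep hij).comp (measurable_id.min measurable_const) (measurable_id.min measurable_const)
  have hYzero : Y 0 = 0 := by
    ext ω
    simp [Y, hnonneg]
  have hlint : ∀ k, ∫⁻ ω, ENNReal.ofReal (Z k ω) ∂μ ≤ ∫⁻ x in Set.Ioi (0 : ℝ), G x := fun k => by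
    rw [lintegral_eq_lintegral_meas_lt μ (Eventually.of_forall (hnonneg k)) (hZ k).aemeasurable]
    exact setLIntegral_mono' measurableSet_Ioi fun x hx => htail k x (le_of_lt hx)
  have hZint : ∀ k, Integrable (Z k) μ := fun k =>
    (lintegral_ofReal_ne_top_iff_integrable (hZ k).aestronglyMeasurable
      (Eventually.of_forall (hnonneg k))).1 ((hlint k).trans_lt hfin).ne
  have hmean : ∀ k, ∫ ω, Z k ω ∂μ ≤ (∫⁻ x in Set.Ioi (0 : ℝ), G x).toReal := fun k => by
    rw [integral_eq_lintegral_of_nonneg_ae (Eventually.of_forall (hnonneg k))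
      (hZ k).aestronglyMeasurable]
    exact ENNReal.toReal_mono hfin.ne (hlint k)
  -- the truncation changes only finitely many terms
  have hEq : ∀ᵐ ω ∂μ, Tendsto (fun k => Z k ω - Y k ω) atTop (nhds 0) := by
    have hsum : ∑' k : ℕ, μ {ω | ((k : ℝ) + 1) < Z (k + 1) ω} ≠ ∞ :=
      ((ENNReal.tsum_le_tsum fun k => htail (k + 1) (k + 1) (by positivity)).trans_lt
        (hG.tsum_succ_le_lintegral_Ioi.trans_lt hfin)).ne
    filter_upwards [ae_eventually_notMem hsum] with ω hω
    rw [← tendsto_add_atTop_iff_nat 1]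
    refine tendsto_const_nhds.congr' ?_
    filter_upwards [hω] with k hk
    simp only [not_lt] at hk
    simp [Y, hk]
  have hbias : Tendsto (fun k => ∫ ω, Z k ω ∂μ - ∫ ω, Y k ω ∂μ) atTop (nhds 0) := by
    have hle : ∀ k : ℕ, ∫⁻ ω, ENNReal.ofReal (Z k ω - Y k ω) ∂μ ≤
        ∫⁻ x in Set.Ioi (0 : ℝ), G (x + k) := fun k => by
      rw [lintegral_eq_lintegral_meas_lt μ (f := fun ω => Z k ω - Y k ω)
        (Eventually.of_forall fun ω => by simp [Y])
        ((hZ k).sub (hYm k)).aemeasurable]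
      refine setLIntegral_mono' measurableSet_Ioi fun x hx => ?_
      refine (measure_mono (Set.ofPred_subset_ofPred.2 fun ω hω => ?_)).trans
        (htail k (x + k) (add_nonneg (le_of_lt hx) k.cast_nonneg))
      simp only [Set.mem_Ioi, Y] at hω hx
      rcases min_choice (Z k ω) (k : ℝ) with h | h <;> rw [h] at hω <;> linarith
    have hlim := tendsto_of_tendsto_of_tendsto_of_le_of_le tendsto_const_nhds
      (hG.tendsto_lintegral_Ioi_add_zero hfin) (fun _ => zero_le) hle
    refine ((ENNReal.tendsto_toReal zero_ne_top).comp hlim).congr fun k => ?_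
    rw [← integral_sub (hZint k) ((hY k).integrable one_le_two),
      integral_eq_lintegral_of_nonneg_ae (f := fun ω => Z k ω - Y k ω)
        (Eventually.of_forall fun ω => by simp [Y])
        ((hZ k).sub (hYm k)).aestronglyMeasurable]
    rfl
  obtain ⟨c, -, cone, clim⟩ :
      ∃ c : ℕ → ℝ, StrictAnti c ∧ (∀ n : ℕ, 1 < c n) ∧ Tendsto c atTop (nhds 1) :=
    exists_seq_strictAnti_tendsto (1 : ℝ)
  have hgeom := fun k => ae_tendsto_sum_sub_div_floor_pow hY hYindep hYzero
    (sum_inv_sq_mul_variance_min_le hZ hnonneg hG hfin htail) (cone k)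
  filter_upwards [ae_all_iff.2 hgeom, hEq] with ω hω hωeq
  have hdiff := (hωeq.sub hbias).cesaro
  simp only [sub_zero] at hdiff
  -- adding a bound on the means makes the partial sums monotone
  set K := (∫⁻ x in Set.Ioi (0 : ℝ), G x).toReal
  have hmono := tendsto_div_of_monotone_of_tendsto_div_floor_pow
    (fun n => ∑ i ∈ Finset.range n, (Z i ω - ∫ ω', Z i ω' ∂μ + K)) K ?_ c cone clim ?_
  · have hlim := hmono.sub_const K
    rw [sub_self] at hlim
    refine hlim.congr' ?_
    filter_upwards [eventually_ne_atTop 0] with n hn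
    have : (n : ℝ) ≠ 0 := by exact_mod_cast hn
    rw [Finset.sum_add_distrib]
    simp only [Finset.sum_const, Finset.card_range, nsmul_eq_mul]
    field_simp
    ring
  · intro m n hmn
    exact Finset.sum_le_sum_of_subset_of_nonneg (Finset.range_mono hmn) fun i _ _ => by
      linarith [hnonneg i ω, hmean i]
  · intro k
    have hfloor : Tendsto (fun n : ℕ => ⌊c k ^ n⌋₊) atTop atTop :=
      tendsto_nat_floor_atTop.comp (tendsto_pow_atTop_atTop_of_one_lt (cone k))
    have hlim := ((hω k).add (hdiff.comp hfloor)).add_const K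
    simp only [add_zero, zero_add] at hlim
    refine hlim.congr fun n => ?_
    have hpos : (⌊c k ^ n⌋₊ : ℝ) ≠ 0 := by
      exact_mod_cast (Nat.floor_pos.2 (one_le_pow₀ (cone k).le)).ne'
    simp only [Function.comp_apply, Finset.sum_add_distrib, Finset.sum_sub_distrib,
      Finset.sum_const, Finset.card_range, nsmul_eq_mul]
    field_simp
    ring

/-- Signed version of `ae_tendsto_sum_sub_integral_div_of_nonneg`. -/
theorem ae_tendsto_sum_sub_integral_div [IsProbabilityMeasure μ] {Z : ℕ → Ω → ℝ}
    (hZ : ∀ k, Measurable (Z k)) (hint : ∀ k, Integrable (Z k) μ)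
    (hindep : Pairwise fun i j => IndepFun (Z i) (Z j) μ)
    {G : ℝ → ℝ≥0∞} (hG : Antitone G) (hfin : ∫⁻ x in Set.Ioi (0 : ℝ), G x < ∞)
    (htail : ∀ k x, 0 ≤ x → μ {ω | x < |Z k ω|} ≤ G x) :
    ∀ᵐ ω ∂μ, Tendsto (fun n : ℕ =>
      (∑ i ∈ Finset.range n, (Z i ω - ∫ ω', Z i ω' ∂μ)) / n) atTop (nhds 0) := by
  have posm : Measurable fun x : ℝ => max x 0 := measurable_id.max measurable_const
  have negm : Measurable fun x : ℝ => max (-x) 0 := measurable_id.neg.max measurable_const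
  have hpos := ae_tendsto_sum_sub_integral_div_of_nonneg (Z := fun k ω => max (Z k ω) 0)
    (fun k => posm.comp (hZ k)) (fun _ _ => le_max_right _ _)
    (fun _ _ hij => (hindep hij).comp posm posm) hG hfin fun k x hx =>
      (measure_mono (Set.ofPred_subset_ofPred.2 fun _ hω =>
        hω.trans_le (max_le (le_abs_self _) (abs_nonneg _)))).trans
        (htail k x hx)
  have hneg := ae_tendsto_sum_sub_integral_div_of_nonneg (Z := fun k ω => max (-Z k ω) 0)
    (fun k => negm.comp (hZ k)) (fun _ _ => le_max_right _ _)
    (fun _ _ hij => (hindep hij).comp negm negm) hG hfin fun k x hx =>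
      (measure_mono (Set.ofPred_subset_ofPred.2 fun _ hω =>
        hω.trans_le (max_le (neg_le_abs _) (abs_nonneg _)))).trans
        (htail k x hx)
  have hmean : ∀ k, ∫ ω, Z k ω ∂μ = ∫ ω, max (Z k ω) 0 ∂μ - ∫ ω, max (-Z k ω) 0 ∂μ := fun k => by
    rw [← integral_sub (hint k).pos_part (hint k).neg_part]
    simp only [max_zero_sub_max_neg_zero_eq_self]
  filter_upwards [hpos, hneg] with ω hωpos hωneg
  have hlim := hωpos.sub hωneg
  rw [sub_zero] at hlim
  refine hlim.congr fun n => ?_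
  rw [← sub_div, ← Finset.sum_sub_distrib]
  congr 1
  refine Finset.sum_congr rfl fun k _ => ?_
  rw [hmean k]
  linarith [max_zero_sub_max_neg_zero_eq_self (Z k ω)]

end



/-- Chandra–Goswami: if `G x = sup_{n ≥ 1} P(|Xₙ| > x)` satisfies `∫_0^∞ G < ∞`, then
for every bounded real sequence `c`, `(1/n) ∑_{k=1}^n c_k (X_k - E X_k) → 0` a.s. -/
theorem chandra_goswami_slln {Ω : Type*} [MeasurableSpace Ω] (μ : Measure Ω)
    [IsProbabilityMeasure μ]
    (X : ℕ → Ω → ℝ) (hmeas : ∀ n, Measurable (X n))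
    (hindep : ∀ i j, i ≠ j → IndepFun (X i) (X j) μ)
    (hint : ∀ n, 1 ≤ n → Integrable (X n) μ)
    (hG : (∫⁻ x in Set.Ioi (0 : ℝ), ⨆ n, ⨆ (_ : 1 ≤ n), μ {ω | x < |X n ω|}) < ⊤)
    (c : ℕ → ℝ) (hc : ∃ M : ℝ, ∀ n, |c n| ≤ M) :
    ∀ᵐ ω ∂μ, Tendsto
      (fun n : ℕ => (∑ k ∈ Finset.Icc 1 n, c k * (X k ω - ∫ ω', X k ω' ∂μ)) / (n : ℝ))
      atTop (nhds 0) := by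
  obtain ⟨M, hM⟩ := hc
  have hMpos : 0 < |M| + 1 := by positivity
  have hc' : ∀ k, |c k / (|M| + 1)| ≤ 1 := fun k => by
    rw [abs_div, abs_of_pos hMpos, div_le_one hMpos]
    linarith [hM k, le_abs_self M]
  have hanti : Antitone fun x : ℝ => ⨆ n, ⨆ (_ : 1 ≤ n), μ {ω | x < |X n ω|} := fun x y hxy =>
    iSup₂_mono fun n _ => measure_mono fun ω hω => hxy.trans_lt hω
  have key := ae_tendsto_sum_sub_integral_div (μ := μ)
    (Z := fun k ω => c (k + 1) / (|M| + 1) * X (k + 1) ω)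
    (fun k => (hmeas _).const_mul _) (fun k => (hint _ (by simp)).const_mul _)
    (fun i j hij => (hindep (i + 1) (j + 1) (by simpa using hij)).comp
      (measurable_id.const_mul _) (measurable_id.const_mul _)) hanti hG fun k x _ => by
      refine (measure_mono (Set.ofPred_subset_ofPred.2 fun ω hω => ?_)).trans
        (le_iSup₂ (f := fun n (_ : 1 ≤ n) => μ {ω | x < |X n ω|}) (k + 1) (by simp))
      refine lt_of_lt_of_le hω ?_
      rw [abs_mul]
      exact mul_le_of_le_one_left (abs_nonneg _) (hc' _)
  filter_upwards [key] with ω hω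
  have hlim := hω.const_mul (|M| + 1)
  rw [mul_zero] at hlim
  refine hlim.congr fun n => ?_
  rw [← mul_div_assoc, Finset.mul_sum, ← Finset.Ico_add_one_right_eq_Icc,
    Finset.sum_Ico_eq_sum_range]
  congr 1
  refine Finset.sum_congr rfl fun k _ => ?_
  rw [integral_const_mul, add_comm 1 k]
  field_simp
end

section
/- Let (X_n)_{n≥1} be a sequence of pairwise independent real-valued random variables with sup_{n≥1} E|X_n| < ∞. Suppose there exist a random variable X with E|X| < ∞ and a constant C > 0 such that sup_{n≥1} (1/n) ∑_{k=1}^{n} P(|X_k| > x) ≤ C · P(|X| > x) for all x ≥ 0. Then (S_n − E S_n)/n → 0 almost surely, where S_n = ∑_{k=1}^{n} X_k. -/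
open MeasureTheory ProbabilityTheory Filter ENNReal

/-- If the tails of `φ ∘ f i` are super-level sets of the `f i`, a bound on the summed tails of the
`f i` by the tails of `g` passes to the expectations of `φ ∘ f i` and `φ ∘ g`. -/
theorem sum_integral_comp_le_of_sum_measure_lt_le {Ω ι : Type*} [MeasurableSpace Ω]
    {μ : Measure Ω} (s : Finset ι) {f : ι → Ω → ℝ} {g : Ω → ℝ} {c : ℝ} (hc : 0 ≤ c)
    (hf : ∀ i ω, 0 ≤ f i ω) (hg : ∀ ω, 0 ≤ g ω)
    (h : ∀ x, 0 ≤ x →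
      ∑ i ∈ s, μ {ω | x < f i ω} ≤ ENNReal.ofReal c * μ {ω | x < g ω})
    {φ : ℝ → ℝ} (hφ : ∀ u, 0 ≤ φ u)
    (hlevel : ∀ t, 0 < t → (∀ u, 0 ≤ u → φ u ≤ t) ∨ ∃ x, 0 ≤ x ∧ ∀ u, 0 ≤ u → (t < φ u ↔ x < u))
    (hfi : ∀ i, Integrable (fun ω => φ (f i ω)) μ) (hgi : Integrable (fun ω => φ (g ω)) μ) :
    ∑ i ∈ s, ∫ ω, φ (f i ω) ∂μ ≤ c * ∫ ω, φ (g ω) ∂μ := by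
  have key : ∑ i ∈ s, ∫⁻ ω, ENNReal.ofReal (φ (f i ω)) ∂μ
      ≤ ENNReal.ofReal c * ∫⁻ ω, ENNReal.ofReal (φ (g ω)) ∂μ := by
    have e : ∀ {u : Ω → ℝ}, Integrable (fun ω => φ (u ω)) μ →
        ∫⁻ ω, ENNReal.ofReal (φ (u ω)) ∂μ = ∫⁻ t in Set.Ioi 0, μ {ω | t < φ (u ω)} := fun hu =>
      lintegral_eq_lintegral_meas_lt μ (Eventually.of_forall fun ω => hφ _) hu.aemeasurable
    have m : ∀ u : Ω → ℝ, Measurable fun t : ℝ => μ {ω | t < φ (u ω)} := fun u =>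
      Antitone.measurable fun a b hab => measure_mono fun ω (hω : b < φ (u ω)) => hab.trans_lt hω
    rw [e hgi, Finset.sum_congr rfl fun i _ => e (hfi i),
      ← lintegral_finsetSum _ fun i _ => m (f i), ← lintegral_const_mul _ (m g)]
    refine setLIntegral_mono' measurableSet_Ioi fun t ht => ?_
    rcases hlevel t ht with h0 | ⟨x, hx, hxu⟩
    · simp [fun i ω => (h0 (f i ω) (hf i ω)).not_gt]
    · simpa only [hxu _ (hf _ _), hxu _ (hg _)] using h x hx
  have hfn : ∀ i, 0 ≤ ∫ ω, φ (f i ω) ∂μ := fun i => integral_nonneg fun ω => hφ _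
  rw [← ENNReal.ofReal_le_ofReal_iff (mul_nonneg hc (integral_nonneg fun ω => hφ _)),
    ENNReal.ofReal_sum_of_nonneg fun i _ => hfn i, ENNReal.ofReal_mul hc,
    ofReal_integral_eq_lintegral_ofReal hgi (Eventually.of_forall fun ω => hφ _)]
  simpa only [fun i => ofReal_integral_eq_lintegral_ofReal (hfi i)
    (Eventually.of_forall fun ω => hφ _)] using key

theorem sum_min_sq_div_sq_le {y : ℝ} (hy : 0 ≤ y) (N : ℕ) :
    ∑ n ∈ Finset.range N, min y (n + 1) ^ 2 / (n + 1 : ℝ) ^ 2 ≤ 4 * y := by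
  rcases hy.eq_or_lt with rfl | hy
  · have : ∀ n : ℕ, min (0 : ℝ) (n + 1) = 0 := fun n => min_eq_left (by positivity)
    simp [this]
  suffices H : ∑ n ∈ Finset.range N, min y (n + 1) ^ 2 / (n + 1 : ℝ) ^ 2
      ≤ 4 * y - 4 * y ^ 2 / (y + N) by
    have : 0 ≤ 4 * y ^ 2 / (y + N) := by positivity
    linarith
  induction N with
  | zero =>
    have : 4 * y ^ 2 / y = 4 * y := by field_simp
    simp [this]
  | succ n ih =>
    rw [Finset.sum_range_succ]
    have h1 : min y (n + 1) / (n + 1 : ℝ) ≤ 2 * y / (y + (n + 1)) := by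
      rw [div_le_div_iff₀ (by positivity) (by positivity)]
      rcases le_total y (n + 1) with h | h
      · rw [min_eq_left h]; nlinarith
      · rw [min_eq_right h]; nlinarith
    have h2 : min y (n + 1) ^ 2 / (n + 1 : ℝ) ^ 2 ≤ (2 * y / (y + (n + 1))) ^ 2 := by
      rw [← div_pow]; gcongr
    have h3 : (2 * y / (y + (n + 1))) ^ 2 ≤ 4 * y ^ 2 / (y + n) - 4 * y ^ 2 / (y + (n + 1)) := by
      have : 4 * y ^ 2 / (y + n) - 4 * y ^ 2 / (y + (n + 1))
          = 4 * y ^ 2 / ((y + n) * (y + (n + 1))) := by field_simp; ring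
      rw [this, div_pow, show (2 * y) ^ 2 = 4 * y ^ 2 by ring]
      gcongr
      nlinarith
    push_cast
    linarith

/-- Summation by parts. -/
theorem sum_div_sq_le_of_sum_le {a b : ℕ → ℝ} {c L : ℝ} (hc : 0 ≤ c)
    (hb : ∀ n, 0 ≤ b n) (hbL : ∀ n : ℕ, b n ≤ (n + 1) * L)
    (hab : ∀ n : ℕ, ∑ k ∈ Finset.range (n + 1), a k ≤ c * (n + 1) * b n) {B : ℝ}
    (hB : ∀ n, ∑ k ∈ Finset.range n, b k / (k + 1 : ℝ) ^ 2 ≤ B) (n : ℕ) :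
    ∑ k ∈ Finset.range n, a k / (k + 1 : ℝ) ^ 2 ≤ 2 * c * B + c * L := by
  have hL : 0 ≤ L := by have := (hb 0).trans (hbL 0); simpa using this
  have parts : ∀ n : ℕ, ∑ k ∈ Finset.range n, a k / (k + 1 : ℝ) ^ 2
      ≤ 2 * c * ∑ k ∈ Finset.range n, b k / (k + 1 : ℝ) ^ 2
        + (∑ k ∈ Finset.range n, a k) / (n + 1 : ℝ) ^ 2 := by
    intro n
    induction n with
    | zero => simp
    | succ n ih =>
      have hs := hab n
      rw [Finset.sum_range_succ (fun k => a k / (k + 1 : ℝ) ^ 2),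
        Finset.sum_range_succ (fun k => b k / (k + 1 : ℝ) ^ 2)]
      have e : (∑ k ∈ Finset.range n, a k) / (n + 1 : ℝ) ^ 2 + a n / (n + 1 : ℝ) ^ 2
          = (∑ k ∈ Finset.range (n + 1), a k) / (n + 1 : ℝ) ^ 2 := by
        rw [Finset.sum_range_succ, add_div]
      set S := ∑ k ∈ Finset.range (n + 1), a k
      have hw : 0 ≤ 1 / (n + 1 : ℝ) ^ 2 - 1 / (n + 2 : ℝ) ^ 2 := by
        rw [sub_nonneg]; gcongr; linarith
      have hw' : 1 / (n + 1 : ℝ) ^ 2 - 1 / (n + 2 : ℝ) ^ 2 ≤ 2 / (n + 1 : ℝ) ^ 3 := by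
        rw [div_sub_div _ _ (by positivity) (by positivity),
          div_le_div_iff₀ (by positivity) (by positivity)]
        have : (0 : ℝ) ≤ n := n.cast_nonneg
        have : 0 ≤ (n + 1 : ℝ) ^ 2 * (2 * (n + 2) ^ 2 - (2 * n + 3) * (n + 1)) := by
          apply mul_nonneg (by positivity); nlinarith
        nlinarith
      have h1 : S * (1 / (n + 1 : ℝ) ^ 2 - 1 / (n + 2 : ℝ) ^ 2)
          ≤ c * (n + 1) * b n * (2 / (n + 1 : ℝ) ^ 3) :=
        (mul_le_mul_of_nonneg_right hs hw).trans
          (mul_le_mul_of_nonneg_left hw' (mul_nonneg (by positivity) (hb n)))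
      have h2 : c * (n + 1) * b n * (2 / (n + 1 : ℝ) ^ 3) = 2 * c * (b n / (n + 1 : ℝ) ^ 2) := by
        field_simp
      have h3 : S * (1 / (n + 1 : ℝ) ^ 2 - 1 / (n + 2 : ℝ) ^ 2)
          = S / (n + 1 : ℝ) ^ 2 - S / (n + 2 : ℝ) ^ 2 := by ring
      push_cast
      rw [show (n + 1 + 1 : ℝ) = n + 2 by ring]
      linarith
  have last : (∑ k ∈ Finset.range n, a k) / (n + 1 : ℝ) ^ 2 ≤ c * L := by
    rw [div_le_iff₀ (by positivity)]
    rcases n with _ | n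
    · simpa using mul_nonneg hc hL
    · push_cast
      calc _ ≤ c * (n + 1) * b n := hab n
        _ ≤ c * (n + 1) * ((n + 1) * L) := by gcongr; exact hbL n
        _ = c * L * (n + 1) ^ 2 := by ring
        _ ≤ _ := by gcongr; linarith
  have := mul_le_mul_of_nonneg_left (hB n) (show 0 ≤ 2 * c by positivity)
  linarith [parts n]

theorem ae_tendsto_zero_of_sum_integral_sq_le {Ω : Type*} [MeasurableSpace Ω] {μ : Measure Ω}
    {W : ℕ → Ω → ℝ} (hW : ∀ n, Measurable (W n)) (hW2 : ∀ n, Integrable (fun ω => W n ω ^ 2) μ)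
    {B : ℝ} (hB : ∀ N, ∑ n ∈ Finset.range N, ∫ ω, W n ω ^ 2 ∂μ ≤ B) :
    ∀ᵐ ω ∂μ, Tendsto (fun n => W n ω) atTop (nhds 0) := by
  have hm : ∀ n, Measurable fun ω => ENNReal.ofReal (W n ω ^ 2) := fun n =>
    ((hW n).pow_const 2).ennreal_ofReal
  have hs : Summable fun n => ∫ ω, W n ω ^ 2 ∂μ :=
    summable_of_sum_range_le (fun n => integral_nonneg fun ω => sq_nonneg _) hB
  have hfin : ∫⁻ ω, ∑' n, ENNReal.ofReal (W n ω ^ 2) ∂μ ≠ ⊤ := by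
    rw [lintegral_tsum fun n => (hm n).aemeasurable]
    simp_rw [← fun n => ofReal_integral_eq_lintegral_ofReal (hW2 n)
      (Eventually.of_forall fun ω => sq_nonneg _)]
    exact hs.tsum_ofReal_ne_top
  filter_upwards [ae_lt_top (Measurable.tsum hm) hfin] with ω hω
  have h0 := ENNReal.tendsto_atTop_zero_of_tsum_ne_top hω.ne
  have h1 := (ENNReal.tendsto_toReal ENNReal.zero_ne_top).comp h0
  have h2 : Tendsto (fun n => W n ω ^ 2) atTop (nhds 0) := by
    simpa [Function.comp_def, ENNReal.toReal_ofReal (sq_nonneg _)] using h1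
  rw [tendsto_zero_iff_abs_tendsto_zero]
  simpa [Function.comp_def, Real.sqrt_sq_eq_abs] using (Real.continuous_sqrt.tendsto 0).comp h2

/-- Strong law for nonnegative pairwise independent random variables with bounded means and
`∑ Var(Z k) / (k + 1) ^ 2 < ∞`. -/
theorem strong_law_of_sum_variance_le {Ω : Type*} [MeasurableSpace Ω] {μ : Measure Ω}
    [IsProbabilityMeasure μ] {Z : ℕ → Ω → ℝ} (hZ : ∀ n, Measurable (Z n))
    (hindep : ∀ i j, i ≠ j → IndepFun (Z i) (Z j) μ) (hZ2 : ∀ n, MemLp (Z n) 2 μ)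
    (hZ0 : ∀ n ω, 0 ≤ Z n ω) {M : ℝ} (hM : ∀ n, ∫ ω, Z n ω ∂μ ≤ M) {B : ℝ}
    (hB : ∀ N, ∑ n ∈ Finset.range N, variance (Z n) μ / (n + 1 : ℝ) ^ 2 ≤ B) :
    ∀ᵐ ω ∂μ, Tendsto (fun n : ℕ => (∑ k ∈ Finset.range n, (Z k ω - ∫ ω', Z k ω' ∂μ)) / (n : ℝ))
      atTop (nhds 0) := by
  have sub : ∀ c : ℝ, 1 < c → ∀ᵐ ω ∂μ, Tendsto (fun n : ℕ =>
      (∑ k ∈ Finset.range ⌊c ^ n⌋₊, (Z k ω - ∫ ω', Z k ω' ∂μ)) / (⌊c ^ n⌋₊ : ℝ))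
      atTop (nhds 0) := by
    intro c hc
    have hint : ∀ n, Integrable (Z n) μ := fun n => (hZ2 n).integrable one_le_two
    have hmem : ∀ m : ℕ, MemLp (∑ k ∈ Finset.range m, Z k) 2 μ := fun m =>
      memLp_finsetSum' _ fun k _ => hZ2 k
    have hcent : ∀ (m : ℕ) (ω : Ω), ∑ k ∈ Finset.range m, (Z k ω - ∫ ω', Z k ω' ∂μ)
        = (∑ k ∈ Finset.range m, Z k) ω - μ[∑ k ∈ Finset.range m, Z k] := by
      intro m ω
      simp only [Finset.sum_apply]
      rw [integral_finsetSum _ fun k _ => hint k, Finset.sum_sub_distrib]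
    have hsq : ∀ m : ℕ, Integrable (fun ω =>
        ((∑ k ∈ Finset.range m, (Z k ω - ∫ ω', Z k ω' ∂μ)) / (m : ℝ)) ^ 2) μ := by
      intro m
      simp_rw [hcent, div_pow]
      exact (((hmem m).sub (memLp_const _)).integrable_sq).div_const _
    have hval : ∀ m : ℕ, ∫ ω, ((∑ k ∈ Finset.range m, (Z k ω - ∫ ω', Z k ω' ∂μ)) / (m : ℝ)) ^ 2 ∂μ
        = ∑ k ∈ Finset.range m, variance (Z k) μ * (1 / (m : ℝ) ^ 2) := by
      intro m
      simp_rw [hcent, div_pow]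
      rw [integral_div, ← variance_eq_integral (hmem m).aemeasurable,
        IndepFun.variance_sum (fun k _ => hZ2 k) fun i _ j _ hij => hindep i j hij,
        ← Finset.sum_mul, mul_one_div]
    refine ae_tendsto_zero_of_sum_integral_sq_le
      (B := 4 * (c ^ 5 * (c - 1)⁻¹ ^ 3) * B) (fun n => ?_) (fun n => hsq _) fun N => ?_
    · fun_prop
    · simp_rw [hval]
      obtain ⟨K, hK⟩ : ∃ K, ∀ i ∈ Finset.range N, ⌊c ^ i⌋₊ ≤ K :=
        ⟨_, fun i hi => Finset.le_sup (f := fun i => ⌊c ^ i⌋₊) hi⟩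
      have hc1 : 0 < c - 1 := sub_pos.2 hc
      calc ∑ i ∈ Finset.range N, ∑ k ∈ Finset.range ⌊c ^ i⌋₊,
            variance (Z k) μ * (1 / (⌊c ^ i⌋₊ : ℝ) ^ 2)
          = ∑ k ∈ Finset.range K, ∑ i ∈ Finset.range N with (k + 1 / 2 : ℝ) < ⌊c ^ i⌋₊,
            variance (Z k) μ * (1 / (⌊c ^ i⌋₊ : ℝ) ^ 2) := by
            refine Finset.sum_comm' fun i k => ?_
            have : (k + 1 / 2 : ℝ) < ⌊c ^ i⌋₊ ↔ k < ⌊c ^ i⌋₊ := by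
              constructor
              · intro h
                have : (k : ℝ) < ⌊c ^ i⌋₊ := by linarith
                exact_mod_cast this
              · intro h
                have : (k + 1 : ℝ) ≤ ⌊c ^ i⌋₊ := by exact_mod_cast h
                linarith
            simp only [Finset.mem_filter, this, Finset.mem_range]
            exact ⟨fun h => ⟨h, h.2.trans_le (hK i (Finset.mem_range.2 h.1))⟩, fun h => h.1⟩
        _ ≤ ∑ k ∈ Finset.range K, variance (Z k) μ *
            (4 * (c ^ 5 * (c - 1)⁻¹ ^ 3) / (k + 1 : ℝ) ^ 2) := by
            refine Finset.sum_le_sum fun k _ => ?_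
            rw [← Finset.mul_sum]
            refine mul_le_mul_of_nonneg_left ?_ (variance_nonneg _ _)
            refine (sum_div_nat_floor_pow_sq_le_div_sq N (by positivity) hc).trans ?_
            rw [div_le_div_iff₀ (by positivity) (by positivity)]
            have : (k + 1 : ℝ) ^ 2 ≤ 4 * (k + 1 / 2 : ℝ) ^ 2 := by
              have : (0 : ℝ) ≤ k := k.cast_nonneg
              nlinarith
            calc _ ≤ c ^ 5 * (c - 1)⁻¹ ^ 3 * (4 * (k + 1 / 2 : ℝ) ^ 2) := by gcongr
              _ = _ := by ring
        _ = 4 * (c ^ 5 * (c - 1)⁻¹ ^ 3) *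
            ∑ k ∈ Finset.range K, variance (Z k) μ / (k + 1 : ℝ) ^ 2 := by
            rw [Finset.mul_sum]
            exact Finset.sum_congr rfl fun k _ => by ring
        _ ≤ _ := by gcongr; exact hB K
  have hall : ∀ᵐ ω ∂μ, ∀ j : ℕ, Tendsto (fun n : ℕ =>
      (∑ k ∈ Finset.range ⌊(1 + 1 / (j + 1 : ℝ)) ^ n⌋₊, (Z k ω - ∫ ω', Z k ω' ∂μ))
        / (⌊(1 + 1 / (j + 1 : ℝ)) ^ n⌋₊ : ℝ)) atTop (nhds 0) :=
    ae_all_iff.2 fun j => sub _ (lt_add_of_pos_right _ (by positivity))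
  filter_upwards [hall] with ω hω
  -- Adding the drift `M * n` makes the centred partial sums monotone.
  have hdrift : ∀ n : ℕ, (n : ℝ) ≠ 0 →
      (∑ k ∈ Finset.range n, (Z k ω - ∫ ω', Z k ω' ∂μ) + M * n) / n
        = (∑ k ∈ Finset.range n, (Z k ω - ∫ ω', Z k ω' ∂μ)) / (n : ℝ) + M := by
    intro n hn
    field_simp
  have main := tendsto_div_of_monotone_of_tendsto_div_floor_pow
    (fun n : ℕ => ∑ k ∈ Finset.range n, (Z k ω - ∫ ω', Z k ω' ∂μ) + M * n) M
    (monotone_nat_of_le_succ fun n => by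
      rw [Finset.sum_range_succ]
      push_cast
      linarith [hZ0 n ω, hM n])
    (fun j : ℕ => 1 + 1 / (j + 1 : ℝ)) (fun j => lt_add_of_pos_right _ (by positivity))
    (by simpa using tendsto_one_div_add_atTop_nhds_zero_nat.const_add (1 : ℝ))
    (fun j => by
      have h := (hω j).add_const M
      rw [zero_add] at h
      refine h.congr fun n => (hdrift _ ?_).symm
      have : 1 ≤ ⌊(1 + 1 / (j + 1 : ℝ)) ^ n⌋₊ :=
        Nat.le_floor (by simpa using one_le_pow₀ (le_add_of_nonneg_right (by positivity)))
      positivity)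
  have := main.sub_const M
  rw [sub_self] at this
  refine this.congr' ?_
  filter_upwards [eventually_gt_atTop 0] with n hn
  rw [hdrift n (by positivity), add_sub_cancel_right]

/-- Strong law for nonnegative pairwise independent random variables with bounded means whose
averaged tails are dominated by the tails of an integrable random variable. -/
theorem strong_law_of_sum_measure_lt_le {Ω : Type*} [MeasurableSpace Ω] {μ : Measure Ω}
    [IsProbabilityMeasure μ] {U : ℕ → Ω → ℝ} (hU : ∀ n, Measurable (U n))
    (hindep : ∀ i j, i ≠ j → IndepFun (U i) (U j) μ) (hU0 : ∀ n ω, 0 ≤ U n ω)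
    (hUi : ∀ n, Integrable (U n) μ) {M : ℝ} (hM : ∀ n, ∫ ω, U n ω ∂μ ≤ M)
    {Y : Ω → ℝ} (hY : Measurable Y) (hY0 : ∀ ω, 0 ≤ Y ω) (hYi : Integrable Y μ)
    {C : ℝ} (hC : 0 ≤ C)
    (hdom : ∀ (n : ℕ) (x : ℝ), 0 ≤ x →
      ∑ k ∈ Finset.range n, μ {ω | x < U k ω} ≤ ENNReal.ofReal (C * n) * μ {ω | x < Y ω}) :
    ∀ᵐ ω ∂μ, Tendsto (fun n : ℕ => (∑ k ∈ Finset.range n, (U k ω - ∫ ω', U k ω' ∂μ)) / (n : ℝ))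
      atTop (nhds 0) := by
  have hY1 : 0 ≤ ∫ ω, Y ω ∂μ := integral_nonneg hY0
  have isq : ∀ {V : Ω → ℝ}, Measurable V → (∀ ω, 0 ≤ V ω) → ∀ A : ℝ, 0 ≤ A →
      Integrable (fun ω => min (V ω) A ^ 2) μ := fun hV hV0 A hA =>
    Integrable.of_bound (by fun_prop) (A ^ 2) (Eventually.of_forall fun ω => by
      rw [Real.norm_eq_abs, abs_of_nonneg (sq_nonneg _)]
      exact pow_le_pow_left₀ (le_min (hV0 ω) hA) (min_le_right _ _) 2)
  have iexc : ∀ {V : Ω → ℝ}, Integrable V μ → ∀ K : ℝ,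
      Integrable (fun ω => max (V ω - K) 0) μ := fun hV K =>
    (hV.sub (integrable_const K)).pos_part
  have hsq : ∀ (n : ℕ) (A : ℝ), 0 ≤ A → ∑ k ∈ Finset.range n, ∫ ω, min (U k ω) A ^ 2 ∂μ
      ≤ C * n * ∫ ω, min (Y ω) A ^ 2 ∂μ := by
    intro n A hA
    refine sum_integral_comp_le_of_sum_measure_lt_le (φ := fun u => min u A ^ 2) _ (by positivity)
      hU0 hY0 (hdom n) (fun u => sq_nonneg _) (fun t ht => ?_) (fun k => isq (hU k) (hU0 k) A hA)
      (isq hY hY0 A hA)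
    have hlt : ∀ u, 0 ≤ u → (t < min u A ^ 2 ↔ √t < u ∧ √t < A) := fun u hu => by
      rw [← lt_min_iff, Real.sqrt_lt ht.le (le_min hu hA)]
    by_cases h : √t < A
    · exact Or.inr ⟨√t, Real.sqrt_nonneg t, fun u hu => by simp [hlt u hu, h]⟩
    · exact Or.inl fun u hu => not_lt.1 fun h' => h ((hlt u hu).1 h').2
  have hexc : ∀ (n : ℕ) (K : ℝ), 0 ≤ K → ∑ k ∈ Finset.range n, ∫ ω, max (U k ω - K) 0 ∂μ
      ≤ C * n * ∫ ω, max (Y ω - K) 0 ∂μ := by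
    intro n K hK
    refine sum_integral_comp_le_of_sum_measure_lt_le (φ := fun u => max (u - K) 0) _
      (by positivity) hU0 hY0 (hdom n) (fun u => le_max_right _ _) (fun t ht => Or.inr
        ⟨t + K, by positivity, fun u hu => ?_⟩) (fun k => iexc (hUi k) K) (iexc hYi K)
    simp [ht.not_gt, lt_sub_iff_add_lt]
  have hZsq : ∀ n : ℕ, Integrable (fun ω => min (U n ω) (n + 1) ^ 2) μ := fun n =>
    isq (hU n) (hU0 n) _ (by positivity)
  have hsum : ∀ N, ∑ k ∈ Finset.range N, (∫ ω, min (U k ω) (k + 1) ^ 2 ∂μ) / (k + 1 : ℝ) ^ 2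
      ≤ 2 * C * (4 * ∫ ω, Y ω ∂μ) + C * ∫ ω, Y ω ∂μ := by
    have hYsq : ∀ n : ℕ, Integrable (fun ω => min (Y ω) (n + 1) ^ 2) μ := fun n =>
      isq hY hY0 _ (by positivity)
    refine sum_div_sq_le_of_sum_le (b := fun n => ∫ ω, min (Y ω) (n + 1) ^ 2 ∂μ) hC
      (fun n => integral_nonneg fun ω => sq_nonneg _) (fun n => ?_) (fun n => ?_) (fun n => ?_)
    · rw [← integral_const_mul]
      refine integral_mono (hYsq n) (hYi.const_mul _) fun ω => ?_
      have h0 : 0 ≤ min (Y ω) (n + 1 : ℝ) := le_min (hY0 ω) (by positivity)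
      simp only [sq]
      exact mul_le_mul (min_le_right _ _) (min_le_left _ _) h0 (by positivity)
    · refine (Finset.sum_le_sum fun k hk => ?_).trans
        ((hsq (n + 1) (n + 1) (by positivity)).trans_eq (by push_cast; rfl))
      refine integral_mono (hZsq k) (isq (hU k) (hU0 k) _ (by positivity)) fun ω => ?_
      have : k ≤ n := Nat.lt_succ_iff.1 (Finset.mem_range.1 hk)
      exact pow_le_pow_left₀ (le_min (hU0 k ω) (by positivity))
        (min_le_min_left _ (by gcongr)) 2
    · simp_rw [← integral_div]
      rw [← integral_finsetSum _ fun k _ => (hYsq k).div_const _, ← integral_const_mul]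
      exact integral_mono (integrable_finsetSum _ fun k _ => (hYsq k).div_const _)
        (hYi.const_mul _) fun ω => sum_min_sq_div_sq_le (hY0 ω) n
  have hZm : ∀ n : ℕ, Measurable fun ω => min (U n ω) (n + 1 : ℝ) := fun n =>
    (hU n).min measurable_const
  have hZ2 : ∀ n : ℕ, MemLp (fun ω => min (U n ω) (n + 1 : ℝ)) 2 μ := fun n =>
    (memLp_two_iff_integrable_sq (hZm n).aestronglyMeasurable).2 (hZsq n)
  have hZi : ∀ n : ℕ, Integrable (fun ω => min (U n ω) (n + 1 : ℝ)) μ := fun n =>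
    (hZ2 n).integrable one_le_two
  have law := strong_law_of_sum_variance_le (Z := fun n ω => min (U n ω) (n + 1)) hZm
    (fun i j hij => (hindep i j hij).comp (φ := fun u => min u (i + 1 : ℝ))
      (ψ := fun u => min u (j + 1 : ℝ)) (by fun_prop) (by fun_prop)) hZ2
    (fun n ω => le_min (hU0 n ω) (by positivity))
    (fun n => (integral_mono (hZi n) (hUi n) fun ω => min_le_left _ _).trans (hM n))
    (fun N => (Finset.sum_le_sum fun k _ => div_le_div_of_nonneg_right
      (variance_le_expectation_sq (hZm k).aestronglyMeasurable) (by positivity)).trans (hsum N))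
  have trunc : ∀ᵐ ω ∂μ, ∀ᶠ k : ℕ in atTop, U k ω < k + 1 := by
    have hs : Summable fun k : ℕ => (∫ ω, min (U k ω) (k + 1) ^ 2 ∂μ) / (k + 1 : ℝ) ^ 2 :=
      summable_of_sum_range_le
        (fun k => div_nonneg (integral_nonneg fun ω => sq_nonneg _) (sq_nonneg _)) hsum
    have hfin : ∑' k : ℕ, μ {ω | (k + 1 : ℝ) ≤ U k ω} ≠ ⊤ := by
      refine ne_top_of_le_ne_top hs.tsum_ofReal_ne_top (ENNReal.tsum_le_tsum fun k => ?_)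
      rw [← ofReal_measureReal]
      refine ENNReal.ofReal_le_ofReal ?_
      rw [le_div_iff₀ (by positivity), mul_comm]
      refine le_trans ?_ (mul_meas_ge_le_integral_of_nonneg
        (Eventually.of_forall fun ω => sq_nonneg _) (hZsq k) ((k + 1 : ℝ) ^ 2))
      refine mul_le_mul_of_nonneg_left (measureReal_mono fun ω hω => ?_) (by positivity)
      simp only [Set.mem_ofPred_eq] at hω ⊢
      rw [min_eq_right hω]
    filter_upwards [ae_eventually_notMem hfin] with ω hω
    exact hω.mono fun k hk => not_le.1 hk
  have mean : Tendsto (fun n : ℕ =>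
      (∑ k ∈ Finset.range n, ∫ ω, max (U k ω - (k + 1)) 0 ∂μ) / (n : ℝ)) atTop (nhds 0) := by
    have tail : Tendsto (fun K : ℕ => C * ∫ ω, max (Y ω - K) 0 ∂μ) atTop (nhds 0) := by
      have := tendsto_integral_of_dominated_convergence (μ := μ)
        (F := fun (K : ℕ) ω => max (Y ω - K) 0) (f := fun _ => 0) Y
        (fun K => (iexc hYi K).aestronglyMeasurable) hYi
        (fun K => Eventually.of_forall fun ω => by
          rw [Real.norm_eq_abs, abs_of_nonneg (le_max_right _ _)]
          exact max_le (sub_le_self _ K.cast_nonneg) (hY0 ω))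
        (Eventually.of_forall fun ω => by
          refine tendsto_const_nhds.congr' ?_
          filter_upwards [eventually_ge_atTop ⌈Y ω⌉₊] with K hK
          exact (max_eq_right (sub_nonpos.2 (Nat.ceil_le.1 hK))).symm)
      simpa using this.const_mul C
    have hpos : ∀ (k : ℕ) (K : ℝ), 0 ≤ ∫ ω, max (U k ω - K) 0 ∂μ := fun k K =>
      integral_nonneg fun ω => le_max_right _ _
    have hM0 : 0 ≤ M := (integral_nonneg (hU0 0)).trans (hM 0)
    have split : ∀ K n : ℕ, ∑ k ∈ Finset.range n, ∫ ω, max (U k ω - (k + 1)) 0 ∂μ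
        ≤ K * M + C * n * ∫ ω, max (Y ω - K) 0 ∂μ := by
      intro K n
      calc _ ≤ ∑ k ∈ Finset.range n,
            ((if k < K then M else 0) + ∫ ω, max (U k ω - K) 0 ∂μ) := by
            refine Finset.sum_le_sum fun k _ => ?_
            split_ifs with hk
            · refine le_add_of_le_of_nonneg ((integral_mono (iexc (hUi k) _) (hUi k)
                fun ω => max_le ?_ (hU0 k ω)).trans (hM k)) (hpos k K)
              linarith [(Nat.cast_nonneg k : (0 : ℝ) ≤ k)]
            · rw [zero_add]
              refine integral_mono (iexc (hUi k) _) (iexc (hUi k) _) fun ω =>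
                max_le_max_right _ ?_
              have : (K : ℝ) ≤ k := by exact_mod_cast not_lt.1 hk
              linarith
        _ ≤ _ := by
            rw [Finset.sum_add_distrib]
            refine add_le_add ?_ (hexc n K K.cast_nonneg)
            rw [← Finset.sum_filter, Finset.sum_const, nsmul_eq_mul]
            gcongr
            refine (Finset.card_le_card (t := Finset.range K) fun k hk => ?_).trans_eq
              (Finset.card_range K)
            exact Finset.mem_range.2 (Finset.mem_filter.1 hk).2
    rw [tendsto_order]
    refine ⟨fun a ha => Eventually.of_forall fun n => ha.trans_le
      (div_nonneg (Finset.sum_nonneg fun k _ => hpos k _) n.cast_nonneg), fun ε hε => ?_⟩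
    obtain ⟨K, hK⟩ := ((tendsto_order.1 tail).2 (ε / 2) (half_pos hε)).exists
    have hKM := tendsto_const_div_atTop_nhds_zero_nat (K * M)
    filter_upwards [(tendsto_order.1 hKM).2 (ε / 2) (half_pos hε), eventually_gt_atTop 0]
      with n hn hn0
    have hn0' : (0 : ℝ) < n := by exact_mod_cast hn0
    calc _ ≤ (K * M + C * n * ∫ ω, max (Y ω - K) 0 ∂μ) / n := by gcongr; exact split K n
      _ = K * M / n + C * ∫ ω, max (Y ω - K) 0 ∂μ := by field_simp
      _ < ε := by linarith
  filter_upwards [law, trunc] with ω h1 h2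
  have h3 : Tendsto (fun k : ℕ => max (U k ω - (k + 1)) 0) atTop (nhds 0) :=
    tendsto_const_nhds.congr' (h2.mono fun k hk => (max_eq_right (by linarith)).symm)
  have h4 := (h1.add h3.cesaro).sub mean
  rw [add_zero, sub_zero] at h4
  refine h4.congr fun n => ?_
  rw [inv_mul_eq_div, ← add_div, ← sub_div, ← Finset.sum_add_distrib, ← Finset.sum_sub_distrib]
  congr 1
  refine Finset.sum_congr rfl fun k _ => ?_
  have hdec : ∀ ω, U k ω = min (U k ω) (k + 1) + max (U k ω - (k + 1)) 0 := fun ω => by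
    rcases le_total (U k ω) (k + 1) with h | h
    · rw [min_eq_left h, max_eq_right (by linarith), add_zero]
    · rw [min_eq_right h, max_eq_left (by linarith)]; ring
  have hE : ∫ ω, U k ω ∂μ = ∫ ω, min (U k ω) (k + 1) ∂μ + ∫ ω, max (U k ω - (k + 1)) 0 ∂μ := by
    rw [← integral_add (hZi k) (iexc (hUi k) _)]
    exact integral_congr_ae (Eventually.of_forall hdec)
  rw [hE]
  linarith [hdec ω]

/-- Kruglov: pairwise independent random variables with `sup_{n≥1} E|X_n| < ∞`, such that
`sup_{n≥1} (1/n) ∑_{k=1}^n P(|X_k| > x) ≤ C P(|X| > x)` for an integrable random variable `X`,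
satisfy `(S_n - E S_n)/n → 0` a.s. -/
theorem kruglov_slln {Ω : Type*} [MeasurableSpace Ω] (μ : Measure Ω)
    [IsProbabilityMeasure μ]
    (X : ℕ → Ω → ℝ) (hmeas : ∀ n, Measurable (X n))
    (hindep : ∀ i j, i ≠ j → IndepFun (X i) (X j) μ)
    (hbdd : (⨆ n, ⨆ (_ : 1 ≤ n), ∫⁻ ω, ENNReal.ofReal |X n ω| ∂μ) < ⊤)
    (Y : Ω → ℝ) (hYmeas : Measurable Y)
    (hYint : (∫⁻ ω, ENNReal.ofReal |Y ω| ∂μ) < ⊤)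
    (C : ℝ) (hC : 0 < C)
    (hdom : ∀ x : ℝ, 0 ≤ x →
      (⨆ n, ⨆ (_ : 1 ≤ n), (∑ k ∈ Finset.Icc 1 n, μ {ω | x < |X k ω|}) / (n : ℝ≥0∞))
        ≤ ENNReal.ofReal C * μ {ω | x < |Y ω|}) :
    ∀ᵐ ω ∂μ, Tendsto
      (fun n : ℕ => ((∑ k ∈ Finset.Icc 1 n, X k ω)
        - ∫ ω', ∑ k ∈ Finset.Icc 1 n, X k ω' ∂μ) / (n : ℝ))
      atTop (nhds 0) := by
  have hM_top := hbdd.ne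
  set M := ⨆ n, ⨆ (_ : 1 ≤ n), ∫⁻ ω, ENNReal.ofReal |X n ω| ∂μ
  have hl1 : ∀ k : ℕ, ∫⁻ ω, ENNReal.ofReal |X (k + 1) ω| ∂μ ≤ M := fun k =>
    le_iSup₂ (f := fun n (_ : 1 ≤ n) => ∫⁻ ω, ENNReal.ofReal |X n ω| ∂μ) (k + 1)
      (Nat.le_add_left 1 k)
  have integrable_of : ∀ {V : Ω → ℝ}, Measurable V →
      (∫⁻ ω, ENNReal.ofReal |V ω| ∂μ) < ⊤ → Integrable V μ := fun hV h =>
    ⟨hV.aestronglyMeasurable, by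
      simpa only [hasFiniteIntegral_iff_norm, Real.norm_eq_abs] using h⟩
  have hXi : ∀ k : ℕ, Integrable (X (k + 1)) μ := fun k =>
    integrable_of (hmeas _) ((hl1 k).trans_lt hbdd)
  have habs : ∀ k : ℕ, ∫ ω, |X (k + 1) ω| ∂μ ≤ M.toReal := fun k => by
    rw [integral_eq_lintegral_of_nonneg_ae (Eventually.of_forall fun ω => abs_nonneg _)
      (hXi k).abs.aestronglyMeasurable]
    exact ENNReal.toReal_mono hM_top (hl1 k)
  have tails : ∀ (n : ℕ) (x : ℝ), 0 ≤ x → ∑ k ∈ Finset.range n, μ {ω | x < |X (k + 1) ω|}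
      ≤ ENNReal.ofReal (C * n) * μ {ω | x < |Y ω|} := by
    intro n x hx
    rcases n.eq_zero_or_pos with rfl | hn
    · simp
    · have h := (le_iSup₂ (f := fun (n : ℕ) (_ : 1 ≤ n) =>
        (∑ k ∈ Finset.Icc 1 n, μ {ω | x < |X k ω|}) / (n : ℝ≥0∞)) n hn).trans (hdom x hx)
      rw [ENNReal.div_le_iff (by exact_mod_cast hn.ne') (ENNReal.natCast_ne_top n)] at h
      rw [ENNReal.ofReal_mul hC.le, ENNReal.ofReal_natCast, mul_right_comm]
      refine le_trans (le_of_eq ?_) h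
      rw [Finset.range_eq_Ico, Finset.sum_Ico_add' (fun k => μ {ω | x < |X k ω|})]
      rfl
  have part : ∀ φ : ℝ → ℝ, Measurable φ → (∀ u, 0 ≤ φ u) → (∀ u, φ u ≤ |u|) →
      ∀ᵐ ω ∂μ, Tendsto (fun n : ℕ => (∑ k ∈ Finset.range n,
        (φ (X (k + 1) ω) - ∫ ω', φ (X (k + 1) ω') ∂μ)) / (n : ℝ)) atTop (nhds 0) := by
    intro φ hφ hφ0 hφle
    have hi : ∀ k : ℕ, Integrable (fun ω => φ (X (k + 1) ω)) μ := fun k =>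
      (hXi k).mono (hφ.comp (hmeas _)).aestronglyMeasurable (Eventually.of_forall fun ω => by
        rw [Real.norm_eq_abs, abs_of_nonneg (hφ0 _)]
        exact hφle _)
    exact strong_law_of_sum_measure_lt_le (U := fun k ω => φ (X (k + 1) ω))
      (fun k => hφ.comp (hmeas _))
      (fun i j hij => (hindep _ _ (by simpa using hij)).comp hφ hφ) (fun k ω => hφ0 _) hi
      (fun k => (integral_mono (hi k) (hXi k).abs fun ω => hφle _).trans (habs k))
      hYmeas.abs (fun ω => abs_nonneg _) (integrable_of hYmeas hYint).abs hC.le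
      (fun n x hx => (Finset.sum_le_sum fun k _ =>
        measure_mono fun ω hω => lt_of_lt_of_le hω (hφle _)).trans (tails n x hx))
  filter_upwards [
    part (fun u => max u 0) (by fun_prop) (fun u => le_max_right _ _)
      (fun u => max_le (le_abs_self u) (abs_nonneg u)),
    part (fun u => max (-u) 0) (by fun_prop) (fun u => le_max_right _ _)
      (fun u => max_le (neg_le_abs u) (abs_nonneg u))] with ω hpos hneg
  have h := hpos.sub hneg
  rw [sub_zero] at h
  refine h.congr fun n => ?_
  have shift : ∀ f : ℕ → ℝ, ∑ k ∈ Finset.Icc 1 n, f k = ∑ k ∈ Finset.range n, f (k + 1) :=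
    fun f => by
      rw [Finset.range_eq_Ico, Finset.sum_Ico_add' f]
      rfl
  simp_rw [shift]
  rw [integral_finsetSum _ fun k _ => hXi k, ← sub_div, ← Finset.sum_sub_distrib,
    ← Finset.sum_sub_distrib]
  congr 1
  refine Finset.sum_congr rfl fun k _ => ?_
  have hE : ∫ ω, X (k + 1) ω ∂μ
      = ∫ ω, max (X (k + 1) ω) 0 ∂μ - ∫ ω, max (-X (k + 1) ω) 0 ∂μ := by
    rw [← integral_sub (hXi k).pos_part (hXi k).neg_part]
    exact integral_congr_ae (Eventually.of_forall fun ω => (max_zero_sub_eq_self _).symm)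
  rw [hE]
  linarith [max_zero_sub_eq_self (X (k + 1) ω)]
end

section
/- Let (X_n)_{n≥1} be a sequence of pairwise independent, integrable real-valued random variables and let (a_n)_{n≥1} be a non-decreasing unbounded sequence of positive real numbers. Set G(x) = sup_{n≥1} (1/a_n) ∑_{k=1}^{n} P(|X_k| > x) for x ≥ 0. If ∫_0^∞ G(x) dx < ∞ and ∑_{n=1}^∞ P(|X_n| > a_n) < ∞, then (S_n − E S_n)/a_n → 0 almost surely, where S_n = ∑_{k=1}^{n} X_k. -/
open MeasureTheory ProbabilityTheory Filter ENNReal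

lemma tsum_ofReal_dyadic_le {x : ℝ} (hx : 0 ≤ x) :
    ∑' j : ℕ, ENNReal.ofReal (if x < 2 ^ (j + 1) then x / 2 ^ j else 0) ≤ ENNReal.ofReal 4 := by
  have key : ∀ N : ℕ, ∑ j ∈ Finset.range N, (if x < 2 ^ (j + 1) then x / 2 ^ j else 0)
      ≤ max 0 (4 - 2 * (x / 2 ^ N)) := by
    intro N
    induction N with
    | zero => simp
    | succ N ih =>
      rw [Finset.sum_range_succ]
      have h2 : (0 : ℝ) < 2 ^ N := by positivity
      have e1 : x / 2 ^ (N + 1) = x / 2 ^ N / 2 := by rw [pow_succ]; field_simp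
      have e2 : (x < 2 ^ (N + 1)) ↔ x / 2 ^ N < 2 := by
        rw [div_lt_iff₀ h2, pow_succ, mul_comm]
      simp only [e1, e2]
      split_ifs with h
      · rw [max_eq_right (by linarith)] at ih
        refine le_max_of_le_right ?_
        linarith
      · rw [max_eq_left (by linarith)] at ih
        exact le_max_of_le_left (by linarith)
  refine ENNReal.tsum_le_of_sum_range_le fun N => ?_
  rw [← ENNReal.ofReal_sum_of_nonneg (fun j _ => by split_ifs <;> positivity)]
  refine ENNReal.ofReal_le_ofReal ((key N).trans (max_le (by norm_num) ?_))
  have : 0 ≤ x / 2 ^ N := by positivity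
  linarith

lemma tsum_lintegral_dyadic_le {G : ℝ → ℝ≥0∞} (hG : Measurable G) :
    ∑' j : ℕ, ∫⁻ x in Set.Ioi (0 : ℝ),
        ENNReal.ofReal (if x < 2 ^ (j + 1) then x / 2 ^ j else 0) * G x
      ≤ ENNReal.ofReal 4 * ∫⁻ x in Set.Ioi (0 : ℝ), G x := by
  have hm : ∀ j : ℕ, Measurable fun x : ℝ =>
      ENNReal.ofReal (if x < 2 ^ (j + 1) then x / 2 ^ j else 0) := fun j =>
    (Measurable.ite measurableSet_Iio (by fun_prop) measurable_const).ennreal_ofReal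
  rw [← lintegral_tsum fun j => ((hm j).fun_mul hG).aemeasurable, ← lintegral_const_mul _ hG]
  refine setLIntegral_mono (hG.const_mul _) fun x hx => ?_
  rw [ENNReal.tsum_mul_right]
  gcongr
  exact tsum_ofReal_dyadic_le (le_of_lt hx)

section Moments

variable {Ω : Type*} [MeasurableSpace Ω] {μ : Measure Ω}

lemma measurable_measure_lt (Y : Ω → ℝ) : Measurable fun t : ℝ => μ {ω | t < Y ω} :=
  Antitone.measurable fun _ _ hst => measure_mono fun _ h => lt_of_le_of_lt hst h

lemma sum_lintegral_ofReal_eq {Y : ℕ → Ω → ℝ} (hY : ∀ k, Measurable (Y k))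
    (hY0 : ∀ k ω, 0 ≤ Y k ω) (s : Finset ℕ) :
    ∑ k ∈ s, ∫⁻ ω, ENNReal.ofReal (Y k ω) ∂μ
      = ∫⁻ t in Set.Ioi (0 : ℝ), ∑ k ∈ s, μ {ω | t < Y k ω} := by
  rw [lintegral_finsetSum _ fun k _ => measurable_measure_lt (Y k)]
  exact Finset.sum_congr rfl fun k _ =>
    lintegral_eq_lintegral_meas_lt μ (ae_of_all _ (hY0 k)) (hY k).aemeasurable

lemma sum_lintegral_ofReal_sq_eq {Y : ℕ → Ω → ℝ} (hY : ∀ k, Measurable (Y k))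
    (hY0 : ∀ k ω, 0 ≤ Y k ω) (s : Finset ℕ) :
    ∑ k ∈ s, ∫⁻ ω, ENNReal.ofReal (Y k ω ^ 2) ∂μ
      = ∫⁻ t in Set.Ioi (0 : ℝ), ENNReal.ofReal (2 * t) * ∑ k ∈ s, μ {ω | t < Y k ω} := by
  simp_rw [Finset.mul_sum]
  rw [lintegral_finsetSum _ fun k _ =>
    (show Measurable fun t : ℝ => ENNReal.ofReal (2 * t) by fun_prop).fun_mul
      (measurable_measure_lt (Y k))]
  refine Finset.sum_congr rfl fun k _ => ?_
  have h := lintegral_rpow_eq_lintegral_meas_lt_mul μ (ae_of_all _ (hY0 k))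
    (hY k).aemeasurable (p := 2) two_pos
  simp only [Real.rpow_two] at h
  rw [h, ← lintegral_const_mul' _ _ ENNReal.ofReal_ne_top]
  refine lintegral_congr fun t => ?_
  rw [show (2 : ℝ) - 1 = 1 by norm_num, Real.rpow_one, ENNReal.ofReal_mul zero_le_two]
  ring

end Moments

/-- A finite index set on which `M` takes values in `[0, L * δ)` is bracketed, up to an oscillation
`δ` of `M`, by at most `2 * L` of its elements. -/
lemma exists_finset_bracketing {B : Set ℕ} (hB : B.Finite) {M : ℕ → ℝ} {δ : ℝ} (hδ : 0 < δ)
    (hM0 : ∀ n ∈ B, 0 ≤ M n) {L : ℕ} (hML : ∀ n ∈ B, M n < L * δ) :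
    ∃ R : Finset ℕ, (∀ r ∈ R, r ∈ B) ∧ R.card ≤ L * 2 ∧
      ∀ n ∈ B, ∃ m ∈ R, ∃ l ∈ R, m ≤ n ∧ n ≤ l ∧ M l ≤ M m + δ := by
  classical
  let F : ℕ → Set ℕ := fun i => {n ∈ B | ⌊M n / δ⌋₊ = i}
  have hF : ∀ i, F i ⊆ B := fun i n hn => hn.1
  refine ⟨((Finset.range L).biUnion fun i => {sInf (F i), sSup (F i)}).filter (· ∈ B),
    fun r hr => (Finset.mem_filter.1 hr).2, ?_, fun n hn => ?_⟩
  · refine (Finset.card_filter_le _ _).trans ?_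
    simpa using Finset.card_biUnion_le_card_mul (Finset.range L)
      (fun i => {sInf (F i), sSup (F i)}) 2 fun i _ => Finset.card_le_two
  · set i := ⌊M n / δ⌋₊ with hi
    have hni : n ∈ F i := ⟨hn, rfl⟩
    have hbdd : BddAbove (F i) := (hB.subset (hF i)).bddAbove
    have hm : sInf (F i) ∈ F i := Nat.sInf_mem ⟨n, hni⟩
    have hl : sSup (F i) ∈ F i := Nat.sSup_mem ⟨n, hni⟩ hbdd
    have hiL : i < L := by
      rw [hi, Nat.floor_lt (div_nonneg (hM0 n hn) hδ.le), div_lt_iff₀ hδ]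
      exact hML n hn
    refine ⟨sInf (F i), ?_, sSup (F i), ?_, Nat.sInf_le hni, le_csSup hbdd hni, ?_⟩
    · exact Finset.mem_filter.2 ⟨Finset.mem_biUnion.2 ⟨i, Finset.mem_range.2 hiL, by simp⟩, hm.1⟩
    · exact Finset.mem_filter.2 ⟨Finset.mem_biUnion.2 ⟨i, Finset.mem_range.2 hiL, by simp⟩, hl.1⟩
    · have h1 := Nat.floor_le (div_nonneg (hM0 _ hm.1) hδ.le)
      have h2 := Nat.lt_floor_add_one (M (sSup (F i)) / δ)
      rw [hm.2, le_div_iff₀ hδ] at h1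
      rw [hl.2, div_lt_iff₀ hδ] at h2
      linarith

lemma exists_pos_lintegral_Ioi_lt {G : ℝ → ℝ≥0∞} (hG : ∫⁻ x in Set.Ioi (0 : ℝ), G x ≠ ∞)
    {ε : ℝ≥0∞} (hε : 0 < ε) : ∃ A : ℝ, 0 < A ∧ ∫⁻ x in Set.Ioi A, G x < ε := by
  let ν := (volume.restrict (Set.Ioi (0 : ℝ))).withDensity G
  have h : Tendsto (ν ∘ fun A : ℝ => Set.Ioi A) atTop (nhds (ν (⋂ A : ℝ, Set.Ioi A))) := by
    refine tendsto_measure_iInter_atTop (fun A => measurableSet_Ioi.nullMeasurableSet)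
      (fun A B h => Set.Ioi_subset_Ioi h) ⟨0, ?_⟩
    simp only [ν]
    rwa [withDensity_apply _ measurableSet_Ioi, Measure.restrict_restrict measurableSet_Ioi,
      Set.inter_self]
  rw [show (⋂ A : ℝ, Set.Ioi A) = ∅ from
    Set.eq_empty_of_forall_notMem fun x hx => lt_irrefl x (Set.mem_iInter.1 hx x),
    measure_empty] at h
  obtain ⟨A, hA, hA0⟩ := ((h.eventually_lt_const hε).and (eventually_gt_atTop 0)).exists
  refine ⟨A, hA0, ?_⟩
  simp only [ν, Function.comp] at hA
  rwa [withDensity_apply _ measurableSet_Ioi, Measure.restrict_restrict measurableSet_Ioi,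
    Set.inter_eq_left.2 (Set.Ioi_subset_Ioi hA0.le)] at hA

section Truncated

variable {Ω : Type*} [MeasurableSpace Ω] {μ : Measure Ω}
  {Y : ℕ → Ω → ℝ} {a : ℕ → ℝ} {G : ℝ → ℝ≥0∞}

lemma integral_sum_le_mul_lintegral (hY : ∀ k, Measurable (Y k)) (hY0 : ∀ k ω, 0 ≤ Y k ω)
    (hYi : ∀ k, Integrable (Y k) μ) (ha : ∀ n, 0 < a n) (hG : Measurable G)
    (hGi : ∫⁻ x in Set.Ioi (0 : ℝ), G x ≠ ∞)
    (hle : ∀ n, ∀ t > 0, ∑ k ∈ Finset.Icc 1 n, μ {ω | t < Y k ω} ≤ ENNReal.ofReal (a n) * G t)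
    (n : ℕ) :
    ∫ ω, ∑ k ∈ Finset.Icc 1 n, Y k ω ∂μ
      ≤ a n * (∫⁻ x in Set.Ioi (0 : ℝ), G x).toReal := by
  rw [← ENNReal.ofReal_le_ofReal_iff (mul_nonneg (ha n).le ENNReal.toReal_nonneg),
    integral_finsetSum _ fun k _ => hYi k,
    ENNReal.ofReal_sum_of_nonneg fun k _ => integral_nonneg (hY0 k),
    Finset.sum_congr rfl fun k _ =>
      ofReal_integral_eq_lintegral_ofReal (hYi k) (ae_of_all _ (hY0 k)),
    sum_lintegral_ofReal_eq hY hY0, ENNReal.ofReal_mul (ha n).le, ENNReal.ofReal_toReal hGi,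
    ← lintegral_const_mul _ hG]
  exact setLIntegral_mono (hG.const_mul _) fun t ht => hle n t ht

variable [IsProbabilityMeasure μ]

lemma memLp_two_of_nonneg_of_le (hY : ∀ k, Measurable (Y k)) (hY0 : ∀ k ω, 0 ≤ Y k ω)
    (hYa : ∀ k ω, Y k ω ≤ a k) (k : ℕ) : MemLp (Y k) 2 μ :=
  MemLp.of_bound (hY k).aestronglyMeasurable (a k) <| ae_of_all _ fun ω => by
    rw [Real.norm_eq_abs, abs_of_nonneg (hY0 k ω)]; exact hYa k ω

lemma ofReal_variance_sum_le (hY : ∀ k, Measurable (Y k)) (hY0 : ∀ k ω, 0 ≤ Y k ω)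
    (hYa : ∀ k ω, Y k ω ≤ a k) (hindep : ∀ i j, i ≠ j → IndepFun (Y i) (Y j) μ)
    (ha_mono : Monotone a) (hG : Measurable G)
    (hle : ∀ n, ∀ t > 0, ∑ k ∈ Finset.Icc 1 n, μ {ω | t < Y k ω} ≤ ENNReal.ofReal (a n) * G t)
    {n j : ℕ} (hn : a n < 2 ^ (j + 1)) :
    ENNReal.ofReal (Var[fun ω => ∑ k ∈ Finset.Icc 1 n, Y k ω; μ])
      ≤ ENNReal.ofReal (4 * 4 ^ j) * ∫⁻ x in Set.Ioi (0 : ℝ),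
        ENNReal.ofReal (if x < 2 ^ (j + 1) then x / 2 ^ j else 0) * G x := by
  have hL := memLp_two_of_nonneg_of_le (μ := μ) hY hY0 hYa
  have hm : Measurable fun x : ℝ =>
      ENNReal.ofReal (if x < 2 ^ (j + 1) then x / 2 ^ j else 0) :=
    (Measurable.ite measurableSet_Iio (by fun_prop) measurable_const).ennreal_ofReal
  have hvar : Var[fun ω => ∑ k ∈ Finset.Icc 1 n, Y k ω; μ]
      = ∑ k ∈ Finset.Icc 1 n, Var[Y k; μ] := by
    rw [← IndepFun.variance_sum (fun k _ => hL k) fun i _ j _ hij => hindep i j hij]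
    congr 1
    ext ω
    simp
  rw [hvar, ENNReal.ofReal_sum_of_nonneg fun k _ => variance_nonneg _ _]
  calc ∑ k ∈ Finset.Icc 1 n, ENNReal.ofReal (Var[Y k; μ])
      ≤ ∑ k ∈ Finset.Icc 1 n, ∫⁻ ω, ENNReal.ofReal (Y k ω ^ 2) ∂μ := by
        refine Finset.sum_le_sum fun k _ => ?_
        rw [← ofReal_integral_eq_lintegral_ofReal (hL k).integrable_sq
          (ae_of_all _ fun ω => sq_nonneg _)]
        exact ENNReal.ofReal_le_ofReal
          (variance_le_expectation_sq (hY k).aestronglyMeasurable)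
    _ = ∫⁻ t in Set.Ioi (0 : ℝ),
          ENNReal.ofReal (2 * t) * ∑ k ∈ Finset.Icc 1 n, μ {ω | t < Y k ω} :=
        sum_lintegral_ofReal_sq_eq hY hY0 _
    _ ≤ ∫⁻ x in Set.Ioi (0 : ℝ), ENNReal.ofReal (4 * 4 ^ j) *
          (ENNReal.ofReal (if x < 2 ^ (j + 1) then x / 2 ^ j else 0) * G x) := by
        refine setLIntegral_mono ((hm.mul hG).const_mul _) fun t ht => ?_
        have ht0 : (0 : ℝ) < t := ht
        split_ifs with h
        · calc _ ≤ ENNReal.ofReal (2 * t) * (ENNReal.ofReal (2 ^ (j + 1)) * G t) := by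
                gcongr
                refine (hle n t ht).trans ?_
                gcongr
            _ = _ := by
                rw [← mul_assoc, ← mul_assoc, ← ENNReal.ofReal_mul (by positivity),
                  ← ENNReal.ofReal_mul (by positivity)]
                congr 2
                rw [show (4 : ℝ) ^ j = 2 ^ j * 2 ^ j by rw [← mul_pow]; norm_num]
                field_simp
                ring
        · rw [Finset.sum_eq_zero, mul_zero]
          · exact zero_le
          · intro k hk
            rw [show {ω | t < Y k ω} = ∅ from Set.eq_empty_of_forall_notMem fun ω hω => ?_,
              measure_empty]
            have h1 := hYa k ω
            have h2 := ha_mono (Finset.mem_Icc.1 hk).2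
            have h3 : t < Y k ω := hω
            linarith
    _ = _ := lintegral_const_mul _ (hm.mul hG)

/-- Almost surely, the centered sums are uniformly small over the dyadic blocks
`{n | 2 ^ j ≤ a n < 2 ^ (j + 1)}` with `j` large. -/
lemma ae_eventually_forall_block_lt (hY : ∀ k, Measurable (Y k)) (hY0 : ∀ k ω, 0 ≤ Y k ω)
    (hYa : ∀ k ω, Y k ω ≤ a k) (hindep : ∀ i j, i ≠ j → IndepFun (Y i) (Y j) μ)
    (ha : ∀ n, 0 < a n) (ha_mono : Monotone a) (ha_top : Tendsto a atTop atTop)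
    (hG : Measurable G) (hGi : ∫⁻ x in Set.Ioi (0 : ℝ), G x ≠ ∞)
    (hle : ∀ n, ∀ t > 0, ∑ k ∈ Finset.Icc 1 n, μ {ω | t < Y k ω} ≤ ENNReal.ofReal (a n) * G t)
    {ε : ℝ} (hε : 0 < ε) :
    ∀ᵐ ω ∂μ, ∀ᶠ j : ℕ in atTop, ∀ n, 2 ^ j ≤ a n → a n < 2 ^ (j + 1) →
      |∑ k ∈ Finset.Icc 1 n, Y k ω - ∫ ω', ∑ k ∈ Finset.Icc 1 n, Y k ω' ∂μ|
        < 2 * (ε * 2 ^ j) := by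
  have hL2 := memLp_two_of_nonneg_of_le (μ := μ) hY hY0 hYa
  have hYi : ∀ k, Integrable (Y k) μ := fun k => (hL2 k).integrable one_le_two
  set S : ℕ → Ω → ℝ := fun n ω => ∑ k ∈ Finset.Icc 1 n, Y k ω with hS
  have hSL : ∀ n, MemLp (S n) 2 μ := fun n => memLp_finsetSum _ fun k _ => hL2 k
  have hSmono : ∀ ω, Monotone fun n => S n ω := fun ω m n hmn =>
    Finset.sum_le_sum_of_subset_of_nonneg (Finset.Icc_subset_Icc_right hmn)
      fun k _ _ => hY0 k ω
  set M : ℕ → ℝ := fun n => ∫ ω, S n ω ∂μ with hM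
  have hMmono : Monotone M := fun m n hmn =>
    integral_mono ((hSL m).integrable one_le_two) ((hSL n).integrable one_le_two)
      fun ω => hSmono ω hmn
  set C := (∫⁻ x in Set.Ioi (0 : ℝ), G x).toReal with hC
  have hC0 : 0 ≤ C := ENNReal.toReal_nonneg
  have hMle : ∀ n, M n ≤ a n * C := integral_sum_le_mul_lintegral hY hY0 hYi ha hG hGi hle
  obtain ⟨L, hL⟩ := exists_nat_gt (2 * C / ε)
  rw [div_lt_iff₀ hε] at hL
  set W : ℕ → ℝ≥0∞ := fun j => ∫⁻ x in Set.Ioi (0 : ℝ),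
    ENNReal.ofReal (if x < 2 ^ (j + 1) then x / 2 ^ j else 0) * G x with hW
  let bad : ℕ → Set Ω := fun j => {ω | ∃ n, 2 ^ j ≤ a n ∧ a n < 2 ^ (j + 1) ∧
    2 * (ε * 2 ^ j) ≤ |S n ω - M n|}
  have hbad : ∀ j, μ (bad j) ≤ ENNReal.ofReal (L * 2 * (4 / ε ^ 2)) * W j := by
    intro j
    have h2j : (0 : ℝ) < 2 ^ j := by positivity
    have hδ : 0 < ε * 2 ^ j := by positivity
    have hBfin : {n | 2 ^ j ≤ a n ∧ a n < 2 ^ (j + 1)}.Finite := by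
      obtain ⟨N, hN⟩ := eventually_atTop.1 (ha_top.eventually_ge_atTop (2 ^ (j + 1)))
      refine (Set.finite_Iio N).subset fun n hn => ?_
      by_contra h
      exact absurd (hN n (not_lt.1 h)) (not_le.2 hn.2)
    obtain ⟨R, hRB, hRcard, hR⟩ := exists_finset_bracketing hBfin hδ (M := M) (L := L)
      (fun n _ => integral_nonneg fun ω => Finset.sum_nonneg fun k _ => hY0 k ω) (fun n hn => by
        have h1 := mul_le_mul_of_nonneg_right hn.2.le hC0
        have h2 := mul_lt_mul_of_pos_right hL h2j
        rw [pow_succ] at h1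
        linarith [hMle n])
    have hsub : bad j ⊆ ⋃ r ∈ R, {ω | ε * 2 ^ j ≤ |S r ω - M r|} := by
      rintro ω ⟨n, hn1, hn2, hn⟩
      obtain ⟨m, hm, l, hl, hmn, hnl, hml⟩ := hR n ⟨hn1, hn2⟩
      by_contra hcon
      simp only [Set.mem_iUnion, Set.mem_ofPred_eq, not_exists, not_le] at hcon
      have h1 := abs_lt.1 (hcon m hm)
      have h2 := abs_lt.1 (hcon l hl)
      have h3 : S m ω ≤ S n ω := hSmono ω hmn
      have h4 : S n ω ≤ S l ω := hSmono ω hnl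
      have h5 := hMmono hmn
      have h6 := hMmono hnl
      refine absurd hn (not_le.2 (abs_lt.2 ⟨?_, ?_⟩)) <;> linarith [h1.1, h1.2, h2.1, h2.2]
    have hcheb : ∀ r ∈ R, μ {ω | ε * 2 ^ j ≤ |S r ω - M r|}
        ≤ ENNReal.ofReal (4 / ε ^ 2) * W j := by
      intro r hr
      refine (meas_ge_le_variance_div_sq (hSL r) hδ).trans ?_
      rw [div_eq_mul_inv, mul_comm, ENNReal.ofReal_mul (by positivity)]
      refine (mul_le_mul_right (ofReal_variance_sum_le hY hY0 hYa hindep ha_mono hG hle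
        (hRB r hr).2) _).trans_eq ?_
      rw [← mul_assoc, ← ENNReal.ofReal_mul (by positivity)]
      congr 2
      rw [show (4 : ℝ) ^ j = 2 ^ j * 2 ^ j by rw [← mul_pow]; norm_num]
      field_simp
    calc μ (bad j) ≤ ∑ r ∈ R, μ {ω | ε * 2 ^ j ≤ |S r ω - M r|} :=
          (measure_mono hsub).trans (measure_biUnion_finset_le _ _)
      _ ≤ R.card • (ENNReal.ofReal (4 / ε ^ 2) * W j) := Finset.sum_le_card_nsmul _ _ _ hcheb
      _ ≤ (L * 2) • (ENNReal.ofReal (4 / ε ^ 2) * W j) := nsmul_le_nsmul_left zero_le hRcard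
      _ = _ := by
          rw [ENNReal.ofReal_mul (by positivity), nsmul_eq_mul, mul_assoc]
          congr 1
          rw [← ENNReal.ofReal_natCast]
          push_cast
          rfl
  have hsum : ∑' j, μ (bad j) ≠ ∞ := by
    refine ne_top_of_le_ne_top ?_ (ENNReal.tsum_le_tsum hbad)
    rw [ENNReal.tsum_mul_left]
    exact ENNReal.mul_ne_top ENNReal.ofReal_ne_top (ne_top_of_le_ne_top
      (ENNReal.mul_ne_top ENNReal.ofReal_ne_top hGi) (tsum_lintegral_dyadic_le hG))
  filter_upwards [ae_eventually_notMem hsum] with ω hω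
  filter_upwards [hω] with j hj n hn1 hn2
  by_contra h
  exact hj ⟨n, hn1, hn2, not_lt.1 h⟩

/-- Strong law for nonnegative variables `Y k` bounded by the norming constants `a k`. -/
lemma ae_tendsto_truncated (hY : ∀ k, Measurable (Y k)) (hY0 : ∀ k ω, 0 ≤ Y k ω)
    (hYa : ∀ k ω, Y k ω ≤ a k) (hindep : ∀ i j, i ≠ j → IndepFun (Y i) (Y j) μ)
    (ha : ∀ n, 0 < a n) (ha_mono : Monotone a) (ha_top : Tendsto a atTop atTop)
    (hG : Measurable G) (hGi : ∫⁻ x in Set.Ioi (0 : ℝ), G x ≠ ∞)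
    (hle : ∀ n, ∀ t > 0, ∑ k ∈ Finset.Icc 1 n, μ {ω | t < Y k ω} ≤ ENNReal.ofReal (a n) * G t) :
    ∀ᵐ ω ∂μ, Tendsto (fun n : ℕ => (∑ k ∈ Finset.Icc 1 n, Y k ω
      - ∫ ω', ∑ k ∈ Finset.Icc 1 n, Y k ω' ∂μ) / a n) atTop (nhds 0) := by
  have h : ∀ᵐ ω ∂μ, ∀ i : ℕ, ∀ᶠ j : ℕ in atTop, ∀ n, 2 ^ j ≤ a n → a n < 2 ^ (j + 1) →
      |∑ k ∈ Finset.Icc 1 n, Y k ω - ∫ ω', ∑ k ∈ Finset.Icc 1 n, Y k ω' ∂μ|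
        < 2 * (1 / ((i : ℝ) + 1) * 2 ^ j) :=
    ae_all_iff.2 fun i => ae_eventually_forall_block_lt hY hY0 hYa hindep ha ha_mono ha_top hG
      hGi hle Nat.one_div_pos_of_nat
  filter_upwards [h] with ω hω
  rw [Metric.tendsto_atTop']
  intro ε hε
  obtain ⟨i, hi⟩ := exists_nat_one_div_lt (half_pos hε)
  obtain ⟨J, hJ⟩ := eventually_atTop.1 (hω i)
  obtain ⟨N, hN⟩ := eventually_atTop.1 (ha_top.eventually_ge_atTop (2 ^ J))
  refine ⟨N, fun n hn => ?_⟩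
  have han := hN n hn.le
  obtain ⟨j, hj1, hj2⟩ := exists_nat_pow_near ((one_le_pow₀ one_le_two).trans han) one_lt_two
  have hJj : J ≤ j := Nat.lt_succ_iff.1 <|
    (pow_lt_pow_iff_right₀ (one_lt_two (α := ℝ))).1 (han.trans_lt hj2)
  have hlt := hJ j hJj n hj1 hj2
  rw [Real.dist_0_eq_abs, abs_div, abs_of_pos (ha n), div_lt_iff₀ (ha n)]
  have h2j : (0 : ℝ) < 2 ^ j := by positivity
  nlinarith [mul_lt_mul_of_pos_right hi h2j, mul_le_mul_of_nonneg_left hj1 hε.le]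

end Truncated

section Nonneg

variable {Ω : Type*} [MeasurableSpace Ω] {μ : Measure Ω}
  {X : ℕ → Ω → ℝ} {a : ℕ → ℝ} {G : ℝ → ℝ≥0∞}

lemma sum_Icc_one_le_tsum (f : ℕ → ℝ≥0∞) (n : ℕ) :
    ∑ k ∈ Finset.Icc 1 n, f k ≤ ∑' k, f (k + 1) := by
  rw [← Finset.Ico_succ_right_eq_Icc, Finset.sum_Ico_eq_sum_range]
  simp_rw [add_comm 1]
  exact ENNReal.sum_le_tsum _

lemma sum_lintegral_tail_le (hX : ∀ k, Measurable (X k)) (ha : ∀ n, 0 < a n)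
    (hG : Measurable G)
    (hle : ∀ n, ∀ t > 0, ∑ k ∈ Finset.Icc 1 n, μ {ω | t < X k ω} ≤ ENNReal.ofReal (a n) * G t)
    {A : ℝ} (hA : 0 < A) (n : ℕ) :
    ∑ k ∈ Finset.Icc 1 n, ∫⁻ ω, ENNReal.ofReal (if a k < X k ω then X k ω else 0) ∂μ
      ≤ (∑' k : ℕ, μ {ω | a (k + 1) < X (k + 1) ω}) * ENNReal.ofReal A
        + ENNReal.ofReal (a n) * ∫⁻ x in Set.Ioi A, G x := by
  have hZ : ∀ k, Measurable fun ω => if a k < X k ω then X k ω else 0 := fun k =>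
    Measurable.ite (measurableSet_lt measurable_const (hX k)) (hX k) measurable_const
  rw [sum_lintegral_ofReal_eq hZ fun k ω => by
    split_ifs with h
    · exact ((ha k).trans h).le
    · exact le_rfl]
  rw [← Set.Ioc_union_Ioi_eq_Ioi hA.le]
  refine (lintegral_union_le _ _ _).trans (add_le_add ?_ ?_)
  · calc _ ≤ ∫⁻ _ in Set.Ioc 0 A, ∑' k : ℕ, μ {ω | a (k + 1) < X (k + 1) ω} := by
          refine setLIntegral_mono measurable_const fun t ht => ?_
          refine (Finset.sum_le_sum fun k _ => measure_mono fun ω hω => ?_).trans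
            (sum_Icc_one_le_tsum (fun k => μ {ω | a k < X k ω}) n)
          have hω' : t < if a k < X k ω then X k ω else 0 := hω
          by_contra h
          exact lt_asymm ht.1 (hω'.trans_eq (if_neg h))
      _ = _ := by simp
  · rw [← lintegral_const_mul _ hG]
    refine setLIntegral_mono (hG.const_mul _) fun t ht => ?_
    have ht0 : 0 < t := hA.trans ht
    refine (Finset.sum_le_sum fun k _ => measure_mono fun ω hω => ?_).trans (hle n t ht0)
    have hω' : t < if a k < X k ω then X k ω else 0 := hω
    by_contra h
    split_ifs at hω'
    · exact h hω'
    · exact lt_asymm ht0 hω'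

lemma tendsto_integral_tail (hX : ∀ k, Measurable (X k))
    (hXi : ∀ k, Integrable (X k) μ) (ha : ∀ n, 0 < a n) (ha_top : Tendsto a atTop atTop)
    (hG : Measurable G) (hGi : ∫⁻ x in Set.Ioi (0 : ℝ), G x ≠ ∞)
    (hle : ∀ n, ∀ t > 0, ∑ k ∈ Finset.Icc 1 n, μ {ω | t < X k ω} ≤ ENNReal.ofReal (a n) * G t)
    (hsum : ∑' k : ℕ, μ {ω | a (k + 1) < X (k + 1) ω} ≠ ∞) :
    Tendsto (fun n : ℕ => (∫ ω, ∑ k ∈ Finset.Icc 1 n, (if a k < X k ω then X k ω else 0) ∂μ) / a n)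
      atTop (nhds 0) := by
  have hZ0 : ∀ k ω, 0 ≤ if a k < X k ω then X k ω else 0 := fun k ω => by
    split_ifs with h
    · exact ((ha k).trans h).le
    · exact le_rfl
  have hZi : ∀ k, Integrable (fun ω => if a k < X k ω then X k ω else 0) μ := fun k =>
    (hXi k).indicator (measurableSet_lt measurable_const (hX k))
  set D := ∑' k : ℕ, μ {ω | a (k + 1) < X (k + 1) ω} with hD
  have hnonneg : ∀ n, 0 ≤ ∫ ω, ∑ k ∈ Finset.Icc 1 n, (if a k < X k ω then X k ω else 0) ∂μ :=
    fun n => integral_nonneg fun ω => Finset.sum_nonneg fun k _ => hZ0 k ω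
  rw [Metric.tendsto_atTop']
  intro ε hε
  obtain ⟨A, hA, hAε⟩ := exists_pos_lintegral_Ioi_lt hGi (ENNReal.ofReal_pos.2 (half_pos hε))
  have hbound : ∀ n, ∫ ω, ∑ k ∈ Finset.Icc 1 n, (if a k < X k ω then X k ω else 0) ∂μ
      ≤ D.toReal * A + a n * (ε / 2) := by
    intro n
    have := (ha n).le
    rw [← ENNReal.ofReal_le_ofReal_iff (by positivity),
      integral_finsetSum _ fun k _ => hZi k,
      ENNReal.ofReal_sum_of_nonneg fun k _ => integral_nonneg (hZ0 k),
      Finset.sum_congr rfl fun k _ =>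
        ofReal_integral_eq_lintegral_ofReal (hZi k) (ae_of_all _ (hZ0 k)),
      ENNReal.ofReal_add (by positivity) (by positivity), ENNReal.ofReal_mul (by positivity),
      ENNReal.ofReal_toReal hsum, ENNReal.ofReal_mul (ha n).le]
    refine (sum_lintegral_tail_le hX ha hG hle hA n).trans ?_
    gcongr
  obtain ⟨N, hN⟩ := eventually_atTop.1 (ha_top.eventually_gt_atTop (D.toReal * A / (ε / 2)))
  refine ⟨N, fun n hn => ?_⟩
  have h1 := hN n hn.le
  rw [div_lt_iff₀ (half_pos hε)] at h1
  rw [Real.dist_0_eq_abs, abs_of_nonneg (div_nonneg (hnonneg n) (ha n).le), div_lt_iff₀ (ha n)]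
  linarith [hbound n]

lemma tendsto_sum_div_of_eventually_eq_zero {z a : ℕ → ℝ} (ha_top : Tendsto a atTop atTop)
    (hz : ∀ᶠ k in atTop, z k = 0) :
    Tendsto (fun n : ℕ => (∑ k ∈ Finset.Icc 1 n, z k) / a n) atTop (nhds 0) := by
  obtain ⟨N, hN⟩ := eventually_atTop.1 hz
  refine (ha_top.const_div_atTop (∑ k ∈ Finset.Icc 1 N, z k)).congr' ?_
  filter_upwards [eventually_ge_atTop N] with n hn
  congr 1
  refine Finset.sum_subset (Finset.Icc_subset_Icc_right hn) fun k hk hk' => hN k ?_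
  simp only [Finset.mem_Icc] at hk hk'
  omega

variable [IsProbabilityMeasure μ]

/-- Strong law with general norming for nonnegative pairwise independent variables. -/
lemma ae_tendsto_of_nonneg (hX : ∀ k, Measurable (X k)) (hX0 : ∀ k ω, 0 ≤ X k ω)
    (hXi : ∀ k, Integrable (X k) μ) (hindep : ∀ i j, i ≠ j → IndepFun (X i) (X j) μ)
    (ha : ∀ n, 0 < a n) (ha_mono : Monotone a) (ha_top : Tendsto a atTop atTop)
    (hG : Measurable G) (hGi : ∫⁻ x in Set.Ioi (0 : ℝ), G x ≠ ∞)
    (hle : ∀ n, ∀ t > 0, ∑ k ∈ Finset.Icc 1 n, μ {ω | t < X k ω} ≤ ENNReal.ofReal (a n) * G t)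
    (hsum : ∑' k : ℕ, μ {ω | a (k + 1) < X (k + 1) ω} ≠ ∞) :
    ∀ᵐ ω ∂μ, Tendsto (fun n : ℕ => (∑ k ∈ Finset.Icc 1 n, X k ω
      - ∫ ω', ∑ k ∈ Finset.Icc 1 n, X k ω' ∂μ) / a n) atTop (nhds 0) := by
  let φ : ℕ → ℝ → ℝ := fun k x => if a k < x then 0 else x
  have hφ : ∀ k, Measurable (φ k) := fun k =>
    Measurable.ite measurableSet_Ioi measurable_const measurable_id
  let Y : ℕ → Ω → ℝ := fun k ω => φ k (X k ω)
  let Z : ℕ → Ω → ℝ := fun k ω => if a k < X k ω then X k ω else 0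
  have hYZ : ∀ k ω, X k ω = Y k ω + Z k ω := fun k ω => by
    simp only [Y, Z, φ]; split_ifs <;> simp
  have hY0 : ∀ k ω, 0 ≤ Y k ω := fun k ω => by
    simp only [Y, φ]
    split_ifs
    · exact le_rfl
    · exact hX0 k ω
  have hYX : ∀ k ω, Y k ω ≤ X k ω := fun k ω => by
    simp only [Y, φ]
    split_ifs
    · exact hX0 k ω
    · exact le_rfl
  have hYa : ∀ k ω, Y k ω ≤ a k := fun k ω => by
    simp only [Y, φ]
    split_ifs with h
    · exact (ha k).le
    · exact not_lt.1 h
  have hY : ∀ k, Measurable (Y k) := fun k => (hφ k).comp (hX k)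
  have hYi : ∀ k, Integrable (Y k) μ := fun k =>
    (memLp_two_of_nonneg_of_le hY hY0 hYa k).integrable one_le_two
  have hZi : ∀ k, Integrable (Z k) μ := fun k =>
    (hXi k).indicator (measurableSet_lt measurable_const (hX k))
  have hT := ae_tendsto_truncated hY hY0 hYa
    (fun i j hij => (hindep i j hij).comp (hφ i) (hφ j)) ha ha_mono ha_top hG hGi
    fun n t ht => (Finset.sum_le_sum fun k _ => measure_mono fun ω hω =>
      lt_of_lt_of_le hω (hYX k ω)).trans (hle n t ht)
  have hEZ : Tendsto (fun n : ℕ => (∫ ω, ∑ k ∈ Finset.Icc 1 n, Z k ω ∂μ) / a n) atTop (nhds 0) :=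
    tendsto_integral_tail hX hXi ha ha_top hG hGi hle hsum
  filter_upwards [hT, ae_eventually_notMem hsum] with ω h1 h2
  have hz : ∀ᶠ k in atTop, Z k ω = 0 := by
    obtain ⟨N, hN⟩ := eventually_atTop.1 h2
    filter_upwards [eventually_ge_atTop (N + 1)] with k hk
    obtain ⟨m, rfl⟩ := Nat.exists_eq_add_of_le' (Nat.le_of_add_left_le hk : 1 ≤ k)
    exact if_neg (hN m (by omega))
  have h3 := (h1.add (tendsto_sum_div_of_eventually_eq_zero ha_top hz)).sub hEZ
  simp only [add_zero, sub_zero] at h3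
  refine h3.congr fun n => ?_
  simp_rw [hYZ, Finset.sum_add_distrib]
  rw [integral_add (integrable_finsetSum _ fun k _ => hYi k)
    (integrable_finsetSum _ fun k _ => hZi k)]
  ring

end Nonneg

/-- Theorem 1: pairwise independent random variables, `(a_n)` non-decreasing, unbounded and
positive; if `G x = sup_{n≥1} (1/a_n) ∑_{k=1}^n P(|X_k| > x)` satisfies `∫_0^∞ G < ∞` and
`∑_{n=1}^∞ P(|X_n| > a_n) < ∞`, then `(S_n - E S_n)/a_n → 0` a.s. -/
theorem slln_general_norming {Ω : Type*} [MeasurableSpace Ω] (μ : Measure Ω)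
    [IsProbabilityMeasure μ]
    (X : ℕ → Ω → ℝ) (hmeas : ∀ n, Measurable (X n))
    (hindep : ∀ i j, i ≠ j → IndepFun (X i) (X j) μ)
    (hint : ∀ n, 1 ≤ n → Integrable (X n) μ)
    (a : ℕ → ℝ) (ha_pos : ∀ n, 0 < a n) (ha_mono : Monotone a)
    (ha_unbdd : Tendsto a atTop atTop)
    (hG : (∫⁻ x in Set.Ioi (0 : ℝ), ⨆ n, ⨆ (_ : 1 ≤ n),
        (∑ k ∈ Finset.Icc 1 n, μ {ω | x < |X k ω|}) / ENNReal.ofReal (a n)) < ⊤)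
    (hsum : (∑' n : ℕ, μ {ω | a (n + 1) < |X (n + 1) ω|}) < ⊤) :
    ∀ᵐ ω ∂μ, Tendsto
      (fun n : ℕ => ((∑ k ∈ Finset.Icc 1 n, X k ω)
        - ∫ ω', ∑ k ∈ Finset.Icc 1 n, X k ω' ∂μ) / a n)
      atTop (nhds 0) := by
  set G : ℝ → ℝ≥0∞ := fun x => ⨆ n, ⨆ (_ : 1 ≤ n),
    (∑ k ∈ Finset.Icc 1 n, μ {ω | x < |X k ω|}) / ENNReal.ofReal (a n) with hGdef
  have hGm : Measurable G := Antitone.measurable fun s t hst =>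
    iSup₂_mono fun n _ => ENNReal.div_le_div_right
      (Finset.sum_le_sum fun k _ => measure_mono fun ω hω => lt_of_le_of_lt hst hω) _
  have hGle : ∀ n, ∀ t, ∑ k ∈ Finset.Icc 1 n, μ {ω | t < |X k ω|}
      ≤ ENNReal.ofReal (a n) * G t := by
    intro n t
    rcases Nat.eq_zero_or_pos n with rfl | hn
    · simp
    · rw [mul_comm, ← ENNReal.div_le_iff (ENNReal.ofReal_pos.2 (ha_pos n)).ne'
        ENNReal.ofReal_ne_top]
      exact le_iSup₂_of_le n hn le_rfl
  -- The sums start at index 1, so `X 0` (possibly not integrable) is replaced by `0`.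
  have key : ∀ ψ : ℝ → ℝ, Measurable ψ → (∀ x, 0 ≤ ψ x) → (∀ x, ψ x ≤ |x|) →
      ∀ᵐ ω ∂μ, Tendsto (fun n : ℕ => (∑ k ∈ Finset.Icc 1 n, ψ (X k ω)
        - ∫ ω', ∑ k ∈ Finset.Icc 1 n, ψ (X k ω') ∂μ) / a n) atTop (nhds 0) := by
    intro ψ hψ hψ0 hψle
    let θ : ℕ → ℝ → ℝ := fun k x => if k = 0 then 0 else ψ x
    have hθ : ∀ k, Measurable (θ k) := fun k => by
      by_cases hk : k = 0 <;> simp only [θ, hk, if_true, if_false]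
      · exact measurable_const
      · exact hψ
    have hθ0 : ∀ k x, 0 ≤ θ k x := fun k x => by
      simp only [θ]
      split_ifs
      · exact le_rfl
      · exact hψ0 x
    have hθle : ∀ k x, θ k x ≤ |x| := fun k x => by
      simp only [θ]
      split_ifs
      · exact abs_nonneg x
      · exact hψle x
    have hθi : ∀ k, Integrable (fun ω => θ k (X k ω)) μ := fun k => by
      by_cases hk : k = 0
      · simp [θ, hk]
      · refine (hint k (Nat.one_le_iff_ne_zero.2 hk)).mono
          ((hθ k).comp (hmeas k)).aestronglyMeasurable (ae_of_all _ fun ω => ?_)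
        rw [Real.norm_eq_abs, abs_of_nonneg (hθ0 k _)]
        exact hθle k _
    have h := ae_tendsto_of_nonneg (fun k => (hθ k).comp (hmeas k)) (fun k ω => hθ0 k _) hθi
      (fun i j hij => (hindep i j hij).comp (hθ i) (hθ j)) ha_pos ha_mono ha_unbdd hGm hG.ne
      (fun n t _ => (Finset.sum_le_sum fun k _ => measure_mono fun ω hω =>
        lt_of_lt_of_le hω (hθle k _)).trans (hGle n t))
      (ne_top_of_le_ne_top hsum.ne <| ENNReal.tsum_le_tsum fun k => measure_mono fun ω hω =>
        (show a (k + 1) < θ (k + 1) (X (k + 1) ω) from hω).trans_le (hθle _ _))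
    have hsumeq : ∀ n ω, ∑ k ∈ Finset.Icc 1 n, (θ k ∘ X k) ω
        = ∑ k ∈ Finset.Icc 1 n, ψ (X k ω) := fun n ω =>
      Finset.sum_congr rfl fun k hk =>
        if_neg (Nat.one_le_iff_ne_zero.1 (Finset.mem_Icc.1 hk).1)
    simpa only [hsumeq] using h
  filter_upwards [key (fun x => max x 0) (by fun_prop) (fun x => le_max_right _ _)
      (fun x => max_le (le_abs_self x) (abs_nonneg x)),
    key (fun x => max (-x) 0) (by fun_prop) (fun x => le_max_right _ _)
      (fun x => max_le (neg_le_abs x) (abs_nonneg x))] with ω h1 h2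
  have h3 := h1.sub h2
  rw [sub_zero] at h3
  refine h3.congr fun n => ?_
  have hX : ∀ k ω, X k ω = max (X k ω) 0 - max (-X k ω) 0 := fun k ω =>
    (max_zero_sub_max_neg_zero_eq_self _).symm
  have hi : ∀ k ∈ Finset.Icc 1 n, Integrable (X k) μ := fun k hk =>
    hint k (Finset.mem_Icc.1 hk).1
  have integral_eq : ∫ ω', ∑ k ∈ Finset.Icc 1 n, X k ω' ∂μ
      = ∫ ω', ∑ k ∈ Finset.Icc 1 n, max (X k ω') 0 ∂μ
        - ∫ ω', ∑ k ∈ Finset.Icc 1 n, max (-X k ω') 0 ∂μ := by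
    rw [← integral_sub (integrable_finsetSum _ fun k hk => (hi k hk).pos_part)
      (integrable_finsetSum _ fun k hk => (hi k hk).neg_part)]
    refine integral_congr_ae (ae_of_all _ fun ω' => ?_)
    simp only [← Finset.sum_sub_distrib, ← hX]
  have sum_eq : ∑ k ∈ Finset.Icc 1 n, X k ω
      = ∑ k ∈ Finset.Icc 1 n, max (X k ω) 0 - ∑ k ∈ Finset.Icc 1 n, max (-X k ω) 0 := by
    simp only [← Finset.sum_sub_distrib, ← hX]
  rw [integral_eq, sum_eq]
  ring
end

section
/- Let (X_n)_{n≥1} be a sequence of pairwise independent, integrable real-valued random variables. Suppose there exists a function H : [0,∞) → [0,∞) that is non-increasing on [0,∞), satisfies ∫_0^∞ H(x) dx < ∞, and satisfies sup_{n≥1} (1/n) ∑_{k=1}^{n} P(|X_k| > x) ≤ H(x) for all x ≥ 0. Then (S_n − E S_n)/n → 0 almost surely, where S_n = ∑_{k=1}^{n} X_k. -/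
open MeasureTheory ProbabilityTheory Filter ENNReal

/-- For an exponentially growing sequence `u`, the kernels `2 x / u n` on `(0, u n]` have bounded
sum. -/
lemma tsum_ite_le_ofReal_div_le {c : ℝ} (hc : 1 < c) {u : ℕ → ℝ} (hl : ∀ n, c ^ n / 2 ≤ u n)
    (hu : ∀ n, u n ≤ c ^ n) {x : ℝ} (hx : 0 < x) :
    ∑' n, (if x ≤ u n then ENNReal.ofReal (2 * x / u n) else 0)
      ≤ ENNReal.ofReal (4 * (1 - c⁻¹)⁻¹) := by
  classical
  have hc0 : 0 < c := by linarith
  have hc1 : c⁻¹ < 1 := inv_lt_one_of_one_lt₀ hc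
  by_cases hex : ∃ n, x ≤ u n
  · set N := Nat.find hex with hN
    have hxN : x ≤ u N := Nat.find_spec hex
    rw [← Summable.sum_add_tsum_nat_add' (k := N) ENNReal.summable, Finset.sum_eq_zero, zero_add]
    · calc ∑' n, (if x ≤ u (n + N) then ENNReal.ofReal (2 * x / u (n + N)) else 0)
          ≤ ∑' n : ℕ, ENNReal.ofReal (4 * c⁻¹ ^ n) := by
            refine ENNReal.tsum_le_tsum fun n => ?_
            split_ifs
            · refine ENNReal.ofReal_le_ofReal ?_
              have h1 := hl (n + N)
              have hp : 0 < c ^ (n + N) := by positivity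
              have h2 : x ≤ c ^ N := hxN.trans (hu N)
              rw [div_le_iff₀ (by linarith)]
              calc 2 * x ≤ 2 * c ^ N := by linarith
                _ = 4 * c⁻¹ ^ n * (c ^ (n + N) / 2) := by
                  rw [pow_add, inv_pow]; field_simp; norm_num
                _ ≤ 4 * c⁻¹ ^ n * u (n + N) := by gcongr
            · exact zero_le
        _ = ENNReal.ofReal (4 * (1 - c⁻¹)⁻¹) := by
            rw [← ENNReal.ofReal_tsum_of_nonneg (fun n => by positivity)
              ((summable_geometric_of_lt_one (by positivity) hc1).mul_left 4), tsum_mul_left,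
              tsum_geometric_of_lt_one (by positivity) hc1]
    · intro n hn
      rw [if_neg (Nat.find_min hex (Finset.mem_range.1 hn))]
  · push Not at hex
    simp [fun n => not_le.2 (hex n)]

lemma tsum_lintegral_mul_ite_lt_top {c : ℝ} (hc : 1 < c) {u : ℕ → ℝ} (hl : ∀ n, c ^ n / 2 ≤ u n)
    (hu : ∀ n, u n ≤ c ^ n) {G : ℝ → ℝ≥0∞} (hG : Measurable G)
    (hGint : ∫⁻ x in Set.Ioi 0, G x ≠ ∞) :
    ∑' n, ∫⁻ x in Set.Ioi 0, G x * (if x ≤ u n then ENNReal.ofReal (2 * x / u n) else 0) ≠ ∞ := by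
  rw [← lintegral_tsum]
  · refine ne_top_of_le_ne_top
      (ENNReal.mul_ne_top hGint (ENNReal.ofReal_ne_top (r := 4 * (1 - c⁻¹)⁻¹))) ?_
    rw [← lintegral_mul_const _ hG]
    refine setLIntegral_mono (by fun_prop) fun x hx => ?_
    rw [ENNReal.tsum_mul_left]
    gcongr
    exact tsum_ite_le_ofReal_div_le hc hl hu hx
  · intro n
    refine (hG.mul (Measurable.ite measurableSet_Iic ?_ measurable_const)).aemeasurable
    fun_prop

section TailBounds

variable {Ω : Type*} [MeasurableSpace Ω] {μ : Measure Ω}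

lemma lintegral_min_sq_le {X : Ω → ℝ} (hX : Measurable X) (hX0 : ∀ ω, 0 ≤ X ω) {u : ℝ}
    (hu : 0 < u) :
    ∫⁻ ω, ENNReal.ofReal ((min (X ω) u / u) ^ 2) ∂μ ≤
      ∫⁻ t in Set.Ioi 0, μ {ω | t < X ω} *
        (if t ≤ u then ENNReal.ofReal (2 * t / u) / ENNReal.ofReal u else 0) := by
  have h := lintegral_comp_eq_lintegral_meas_lt_mul μ (f := fun ω => min (X ω) u)
    (g := fun t => 2 * t / u / u) (ae_of_all _ fun ω => le_min (hX0 ω) hu.le)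
    (hX.min measurable_const).aemeasurable
    (fun t _ => Continuous.intervalIntegrable (by fun_prop) _ _)
    ((ae_restrict_iff' measurableSet_Ioi).2 (ae_of_all _ fun t (ht : 0 < t) => by positivity))
  have e : ∀ y : ℝ, ∫ t in (0 : ℝ)..y, 2 * t / u / u = (y / u) ^ 2 := by
    intro y
    simp only [intervalIntegral.integral_div]
    rw [intervalIntegral.integral_const_mul, integral_id]
    field
  simp only [e] at h
  rw [h]
  refine setLIntegral_mono' measurableSet_Ioi fun t _ => ?_
  split_ifs with htu
  · rw [ENNReal.ofReal_div_of_pos hu]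
    gcongr
    exact min_le_left _ _
  · have : {a | t < min (X a) u} = ∅ := by
      ext a
      simp only [Set.mem_ofPred_eq, lt_min_iff, Set.mem_empty_iff_false, iff_false]
      exact fun h => htu h.2.le
    rw [this]
    simp

lemma sum_lintegral_min_sq_le {X : ℕ → Ω → ℝ} (hX : ∀ k, Measurable (X k))
    (hX0 : ∀ k ω, 0 ≤ X k ω) {G : ℝ → ℝ≥0∞}
    (hdom : ∀ (n : ℕ) (x : ℝ), 0 ≤ x → ∑ k ∈ Finset.range n, μ {ω | x < X k ω} ≤ n * G x)
    {n : ℕ} (hn : 0 < n) :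
    ∑ k ∈ Finset.range n, ∫⁻ ω, ENNReal.ofReal ((min (X k ω) n / n) ^ 2) ∂μ ≤
      ∫⁻ t in Set.Ioi 0, G t * (if t ≤ n then ENNReal.ofReal (2 * t / n) else 0) := by
  have hn' : (0 : ℝ) < n := by exact_mod_cast hn
  refine (Finset.sum_le_sum fun k _ => lintegral_min_sq_le (hX k) (hX0 k) hn').trans ?_
  have hm : ∀ k, Measurable fun t : ℝ => μ {ω | t < X k ω} := fun k =>
    Antitone.measurable fun s t hst => measure_mono fun ω (h : t < X k ω) => hst.trans_lt h
  rw [← lintegral_finsetSum]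
  · refine setLIntegral_mono' measurableSet_Ioi fun t ht => ?_
    rw [← Finset.sum_mul]
    refine (mul_le_mul_left (hdom n t (le_of_lt ht)) _).trans (le_of_eq ?_)
    split_ifs
    · rw [ENNReal.ofReal_natCast, mul_comm (n : ℝ≥0∞), mul_assoc, ENNReal.mul_div_cancel]
      · exact_mod_cast hn.ne'
      · exact ENNReal.natCast_ne_top n
    · simp
  · intro k _
    refine (hm k).mul (Measurable.ite measurableSet_Iic ?_ measurable_const)
    fun_prop

lemma lintegral_sub_eq_lintegral_meas_lt {X : Ω → ℝ} (hX : Measurable X) (M : ℝ) :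
    ∫⁻ ω, ENNReal.ofReal (X ω - M) ∂μ = ∫⁻ t in Set.Ioi M, μ {ω | t < X ω} := by
  have h := lintegral_eq_lintegral_meas_lt μ (f := fun ω => max (X ω - M) 0)
    (ae_of_all _ fun ω => le_max_right _ _)
    ((hX.sub measurable_const).max measurable_const).aemeasurable
  have e := (measurePreserving_add_right volume M).setLIntegral_comp_preimage_emb
    (measurableEmbedding_addRight M) (fun t => μ {ω | t < X ω}) (Set.Ioi M)
  rw [← e]
  simp only [ENNReal.ofReal_max, ENNReal.ofReal_zero, max_zero] at h
  rw [h, Set.preimage_add_const_Ioi, sub_self]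
  refine setLIntegral_congr_fun measurableSet_Ioi fun t (ht : 0 < t) => ?_
  congr 1
  ext ω
  simp [lt_sub_iff_add_lt, ht.not_gt]

lemma sum_integral_max_sub_le {X : ℕ → Ω → ℝ} (hX : ∀ k, Measurable (X k))
    (hint : ∀ k, Integrable (X k) μ) [IsFiniteMeasure μ] {G : ℝ → ℝ≥0∞}
    (hdom : ∀ (n : ℕ) (x : ℝ), 0 ≤ x → ∑ k ∈ Finset.range n, μ {ω | x < X k ω} ≤ n * G x)
    {M ε : ℝ} (hM : 0 ≤ M) (hε : 0 ≤ ε) (hG : ∫⁻ t in Set.Ioi M, G t ≤ ENNReal.ofReal ε) (n : ℕ) :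
    ∑ k ∈ Finset.range n, ∫ ω, max (X k ω - M) 0 ∂μ ≤ n * ε := by
  have hm : ∀ k, Measurable fun t : ℝ => μ {ω | t < X k ω} := fun k =>
    Antitone.measurable fun s t hst => measure_mono fun ω (h : t < X k ω) => hst.trans_lt h
  have hi : ∀ k, Integrable (fun ω => max (X k ω - M) 0) μ := fun k =>
    ((hint k).sub (integrable_const M)).pos_part
  have hp : ∀ k, 0 ≤ ∫ ω, max (X k ω - M) 0 ∂μ := fun k =>
    integral_nonneg fun ω => le_max_right _ _
  rw [← ENNReal.ofReal_le_ofReal_iff (by positivity),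
    ENNReal.ofReal_sum_of_nonneg fun k _ => hp k]
  calc ∑ k ∈ Finset.range n, ENNReal.ofReal (∫ ω, max (X k ω - M) 0 ∂μ)
      = ∑ k ∈ Finset.range n, ∫⁻ t in Set.Ioi M, μ {ω | t < X k ω} := by
        refine Finset.sum_congr rfl fun k _ => ?_
        rw [ofReal_integral_eq_lintegral_ofReal (hi k) (ae_of_all _ fun ω => le_max_right _ _),
          ← lintegral_sub_eq_lintegral_meas_lt (hX k)]
        simp only [ENNReal.ofReal_max, ENNReal.ofReal_zero, max_zero]
    _ = ∫⁻ t in Set.Ioi M, ∑ k ∈ Finset.range n, μ {ω | t < X k ω} :=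
        (lintegral_finsetSum _ fun k _ => hm k).symm
    _ ≤ ∫⁻ t in Set.Ioi M, n * G t :=
        setLIntegral_mono' measurableSet_Ioi fun t ht => hdom n t (hM.trans (le_of_lt ht))
    _ = n * ∫⁻ t in Set.Ioi M, G t := lintegral_const_mul' _ _ (ENNReal.natCast_ne_top n)
    _ ≤ n * ENNReal.ofReal ε := by gcongr
    _ = ENNReal.ofReal (n * ε) := by
        rw [ENNReal.ofReal_mul (by positivity), ENNReal.ofReal_natCast]

end TailBounds

lemma tendsto_setLIntegral_Ioi_natCast {G : ℝ → ℝ≥0∞} (hG : Measurable G)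
    (hGint : ∫⁻ x in Set.Ioi 0, G x ≠ ∞) :
    Tendsto (fun n : ℕ => ∫⁻ x in Set.Ioi (n : ℝ), G x) atTop (nhds 0) := by
  have h := tendsto_lintegral_of_dominated_convergence (μ := volume.restrict (Set.Ioi (0 : ℝ)))
    (F := fun n : ℕ => (Set.Ioi (n : ℝ)).indicator G) (f := fun _ => 0) G
    (fun n => hG.indicator measurableSet_Ioi)
    (fun n => ae_of_all _ fun x => Set.indicator_le_self _ _ x) hGint
    (ae_of_all _ fun x => by
      refine tendsto_const_nhds.congr' ?_
      obtain ⟨N, hN⟩ := exists_nat_ge x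
      filter_upwards [Ici_mem_atTop N] with n hn
      rw [Set.indicator_of_notMem]
      exact not_lt.2 (hN.trans (by exact_mod_cast hn)))
  simp only [lintegral_zero] at h
  refine h.congr fun n => ?_
  rw [lintegral_indicator measurableSet_Ioi, Measure.restrict_restrict measurableSet_Ioi,
    Set.inter_eq_left.2 (Set.Ioi_subset_Ioi n.cast_nonneg)]

lemma eventually_floor_pow_succ_le {c a : ℝ} (hc : 1 < c) (hca : c < a) :
    ∀ᶠ n : ℕ in atTop, (⌊c ^ (n + 1)⌋₊ : ℝ) ≤ a * ⌊c ^ n⌋₊ := by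
  have h := (tendsto_pow_atTop_atTop_of_one_lt hc).eventually_ge_atTop (a / (a - c))
  filter_upwards [h] with n hn
  have hac : 0 < a - c := by linarith
  rw [div_le_iff₀ hac] at hn
  have h1 : (⌊c ^ (n + 1)⌋₊ : ℝ) ≤ c ^ n * c :=
    (Nat.floor_le (by positivity)).trans_eq (pow_succ _ _)
  have h2 : c ^ n < ⌊c ^ n⌋₊ + 1 := Nat.lt_floor_add_one _
  nlinarith

/-- A monotone sequence `s` is approximated by a centering `e` whose increments are controlled, as
soon as this holds along subsequences with growth ratio arbitrarily close to `1`. -/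
lemma tendsto_sub_div_of_monotone_of_exists_subseq {s e : ℕ → ℝ} (hs : Monotone s)
    (he : Monotone e)
    (hinc : ∀ ε : ℝ, 0 < ε → ∃ M : ℝ, 0 ≤ M ∧ ∀ m n : ℕ, m ≤ n →
      e n - e m ≤ M * ((n : ℝ) - m) + ε * n)
    (hlim : ∀ a : ℝ, 1 < a → ∃ c : ℕ → ℕ, (∀ᶠ n in atTop, (c (n + 1) : ℝ) ≤ a * c n) ∧
      Tendsto c atTop atTop ∧ Tendsto (fun n => (s (c n) - e (c n)) / c n) atTop (nhds 0)) :
    Tendsto (fun n : ℕ => (s n - e n) / n) atTop (nhds 0) := by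
  rw [← Asymptotics.isLittleO_iff_tendsto' (by
    filter_upwards [Ioi_mem_atTop 0] with n (hn : 0 < n) h
    exact absurd h (by positivity)), Asymptotics.isLittleO_iff]
  intro δ hδ
  set ε := δ / 5 with hε
  have hε0 : 0 < ε := by positivity
  obtain ⟨M, hM, hinc⟩ := hinc ε hε0
  set η := min 1 (ε / (M + 1)) with hη
  have hη0 : 0 < η := by positivity
  have hη1 : η ≤ 1 := min_le_left _ _
  have hηM : M * η ≤ ε := by
    have : η ≤ ε / (M + 1) := min_le_right _ _
    rw [le_div_iff₀ (by positivity)] at this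
    nlinarith
  obtain ⟨c, cgrowth, ctop, clim⟩ := hlim (1 + η) (by linarith)
  have L : ∀ᶠ n in atTop, |s (c n) - e (c n)| ≤ ε * c n := by
    filter_upwards [(Metric.tendsto_nhds.1 clim) ε hε0, ctop (Ioi_mem_atTop 0)] with n hn hpos
    have hpos' : (0 : ℝ) < c n := by exact_mod_cast hpos
    rw [Real.dist_eq, sub_zero, abs_div, abs_of_pos hpos', div_lt_iff₀ hpos'] at hn
    exact hn.le
  obtain ⟨a, ha⟩ := eventually_atTop.1 (cgrowth.and L)
  filter_upwards [Ici_mem_atTop ((Finset.range (a + 1)).sup c)] with n hn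
  have exN : ∃ N, n < c N := by
    obtain ⟨N, hN⟩ := (tendsto_atTop.1 ctop (n + 1)).exists
    exact ⟨N, by lia⟩
  classical
  obtain ⟨N, hN1, hN2⟩ : ∃ N, c N ≤ n ∧ n < c (N + 1) ∧ a ≤ N := by
    have hspec := Nat.find_spec exN
    have aN : a + 1 ≤ Nat.find exN := by
      by_contra! h
      have := Finset.le_sup (f := c) (Finset.mem_range.2 h)
      exact absurd hspec (not_lt.2 (this.trans hn))
    refine ⟨Nat.find exN - 1, not_lt.1 (Nat.find_min exN (by lia)), ?_, by lia⟩
    rwa [Nat.sub_add_cancel (by lia)]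
  obtain ⟨hN2, haN⟩ := hN2
  have h1 := (ha N haN).1
  have h2 := abs_le.1 (ha N haN).2
  have h3 := abs_le.1 (ha (N + 1) (by lia)).2
  have h4 := hinc (c N) (c (N + 1)) (by lia)
  have hcn : (c N : ℝ) ≤ n := by exact_mod_cast hN1
  have h0 : (0 : ℝ) ≤ c N := Nat.cast_nonneg _
  have h5 : M * ((c (N + 1) : ℝ) - c N) ≤ ε * n := by
    calc M * ((c (N + 1) : ℝ) - c N) ≤ M * (η * c N) := by gcongr; linarith
      _ = (M * η) * c N := by ring
      _ ≤ ε * n := by gcongr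
  have h6 : ε * (c (N + 1) : ℝ) ≤ 2 * (ε * n) := by
    calc ε * (c (N + 1) : ℝ) ≤ ε * (2 * n) := by
          gcongr
          nlinarith
      _ = 2 * (ε * n) := by ring
  have h7 : ε * (c N : ℝ) ≤ ε * n := by gcongr
  have hδn : δ * n = 5 * (ε * n) := by rw [hε]; ring
  have m1 := hs hN1
  have m2 := hs hN2.le
  have m3 := he hN1
  have m4 := he hN2.le
  have hεn : 0 ≤ ε * n := by positivity
  rw [Real.norm_eq_abs, Real.norm_eq_abs, Nat.abs_cast, abs_le, hδn]
  constructor <;> linarith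

section StrongLaw

variable {Ω : Type*} [MeasurableSpace Ω] {μ : Measure Ω}

lemma ae_tendsto_sub_integral_of_tsum_evariance {W : ℕ → Ω → ℝ} (hW : ∀ n, Measurable (W n))
    (h : ∑' n, evariance (W n) μ ≠ ∞) :
    ∀ᵐ ω ∂μ, Tendsto (fun n => W n ω - ∫ ω', W n ω' ∂μ) atTop (nhds 0) := by
  have hm : ∀ n, Measurable fun ω => ENNReal.ofReal ((W n ω - ∫ ω', W n ω' ∂μ) ^ 2) := fun n =>
    (((hW n).sub_const _).pow_const 2).ennreal_ofReal
  simp only [evariance_eq_lintegral_ofReal] at h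
  rw [← lintegral_tsum fun n => (hm n).aemeasurable] at h
  filter_upwards [ae_lt_top (Measurable.tsum hm) h] with ω hω
  have h0 := ENNReal.tendsto_atTop_zero_of_tsum_ne_top hω.ne
  have h1 := (Real.continuous_sqrt.tendsto 0).comp
    ((ENNReal.tendsto_toReal ENNReal.zero_ne_top).comp h0)
  rw [Real.sqrt_zero] at h1
  refine squeeze_zero_norm (fun n => le_of_eq ?_) h1
  simp [ENNReal.toReal_ofReal (sq_nonneg _), Real.sqrt_sq_eq_abs]

variable [IsProbabilityMeasure μ]

lemma evariance_sum_min_div_le {X : ℕ → Ω → ℝ} (hX : ∀ k, Measurable (X k))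
    (hX0 : ∀ k ω, 0 ≤ X k ω) (hindep : Pairwise fun i j => IndepFun (X i) (X j) μ) (s : Finset ℕ)
    {u : ℝ} (hu : 0 ≤ u) :
    evariance (fun ω => ∑ k ∈ s, min (X k ω) u / u) μ ≤
      ∑ k ∈ s, ∫⁻ ω, ENNReal.ofReal ((min (X k ω) u / u) ^ 2) ∂μ := by
  have hf : Measurable fun y : ℝ => min y u / u := by fun_prop
  have hYm : ∀ k, Measurable fun ω => min (X k ω) u / u := fun k => hf.comp (hX k)
  have hY : ∀ k, MemLp (fun ω => min (X k ω) u / u) 2 μ := fun k =>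
    MemLp.of_bound (hYm k).aestronglyMeasurable 1 (ae_of_all _ fun ω => by
      rw [Real.norm_of_nonneg (div_nonneg (le_min (hX0 k ω) hu) hu)]
      exact div_le_one_of_le₀ (min_le_right _ _) hu)
  have hsum : (fun ω => ∑ k ∈ s, min (X k ω) u / u) =
      ∑ k ∈ s, fun ω => min (X k ω) u / u := by
    ext ω; simp
  rw [hsum, ← ofReal_variance (memLp_finsetSum' s fun k _ => hY k),
    IndepFun.variance_sum (fun k _ => hY k) (fun i _ j _ hij => (hindep hij).comp hf hf),
    ENNReal.ofReal_sum_of_nonneg fun k _ => variance_nonneg _ _]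
  refine Finset.sum_le_sum fun k _ => ?_
  rw [← ofReal_integral_eq_lintegral_ofReal (hY k).integrable_sq
    (ae_of_all _ fun ω => sq_nonneg _)]
  exact ENNReal.ofReal_le_ofReal (variance_le_expectation_sq (hYm k).aestronglyMeasurable)

lemma ae_tendsto_sub_div_floor_pow {X : ℕ → Ω → ℝ} (hX : ∀ k, Measurable (X k))
    (hX0 : ∀ k ω, 0 ≤ X k ω) (hindep : Pairwise fun i j => IndepFun (X i) (X j) μ)
    (hint : ∀ k, Integrable (X k) μ) {G : ℝ → ℝ≥0∞} (hG : Measurable G)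
    (hGint : ∫⁻ x in Set.Ioi 0, G x ≠ ∞)
    (hdom : ∀ (n : ℕ) (x : ℝ), 0 ≤ x → ∑ k ∈ Finset.range n, μ {ω | x < X k ω} ≤ n * G x)
    {c : ℝ} (hc : 1 < c) :
    ∀ᵐ ω ∂μ, Tendsto (fun n : ℕ => (∑ k ∈ Finset.range ⌊c ^ n⌋₊, X k ω -
      ∑ k ∈ Finset.range ⌊c ^ n⌋₊, ∫ ω', X k ω' ∂μ) / (⌊c ^ n⌋₊ : ℝ)) atTop (nhds 0) := by
  set u : ℕ → ℕ := fun n => ⌊c ^ n⌋₊ with hu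
  have hc1 : ∀ n : ℕ, 1 ≤ c ^ n := fun n => one_le_pow₀ hc.le
  have hu0 : ∀ n, 0 < u n := fun n => Nat.floor_pos.2 (hc1 n)
  have hu0' : ∀ n, (0 : ℝ) < u n := fun n => Nat.cast_pos.2 (hu0 n)
  have hutop : Tendsto u atTop atTop :=
    tendsto_nat_floor_atTop.comp (tendsto_pow_atTop_atTop_of_one_lt hc)
  have hul : ∀ n, c ^ n / 2 ≤ u n := fun n => by
    have h1 : c ^ n < u n + 1 := Nat.lt_floor_add_one _
    have h2 : (1 : ℝ) ≤ u n := by exact_mod_cast hu0 n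
    linarith
  have huu : ∀ n, (u n : ℝ) ≤ c ^ n := fun n => Nat.floor_le (by linarith [hc1 n])
  set V : ℕ → ℝ≥0∞ := fun n => ∑ k ∈ Finset.range (u n),
    ∫⁻ ω, ENNReal.ofReal ((min (X k ω) (u n) / (u n)) ^ 2) ∂μ with hV
  have hVsum : ∑' n, V n ≠ ∞ :=
    ne_top_of_le_ne_top (tsum_lintegral_mul_ite_lt_top hc hul huu hG hGint)
      (ENNReal.tsum_le_tsum fun n => sum_lintegral_min_sq_le hX hX0 hdom (hu0 n))
  set W : ℕ → Ω → ℝ := fun n ω => ∑ k ∈ Finset.range (u n), min (X k ω) (u n) / (u n) with hW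
  have hWvar := ae_tendsto_sub_integral_of_tsum_evariance (μ := μ) (W := W)
    (fun n => Finset.measurable_fun_sum _ fun k _ => by fun_prop)
    (ne_top_of_le_ne_top hVsum (ENNReal.tsum_le_tsum fun n =>
      evariance_sum_min_div_le hX hX0 hindep _ (hu0' n).le))
  have hBC := ae_eventually_notMem (μ := μ)
    (s := fun n => ⋃ k ∈ Finset.range (u n), {ω | (u n : ℝ) < X k ω})
    (ne_top_of_le_ne_top hVsum (ENNReal.tsum_le_tsum fun n => by
      refine (measure_biUnion_finset_le _ _).trans (Finset.sum_le_sum fun k _ => ?_)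
      have hmk := mul_meas_ge_le_lintegral (μ := μ)
        (f := fun ω => ENNReal.ofReal ((min (X k ω) (u n) / (u n)) ^ 2)) (by fun_prop) 1
      rw [one_mul] at hmk
      refine (measure_mono fun ω (hω : (u n : ℝ) < X k ω) => ?_).trans hmk
      simp [min_eq_right hω.le, (hu0' n).ne']))
  have hmean : Tendsto (fun n => ∫ ω, W n ω ∂μ -
      (∑ k ∈ Finset.range (u n), ∫ ω, X k ω ∂μ) / (u n : ℝ)) atTop (nhds 0) := by
    rw [Metric.tendsto_nhds]
    intro ε hε
    have hev := ((tendsto_setLIntegral_Ioi_natCast hG hGint).comp hutop).eventually_le_const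
      (ENNReal.ofReal_pos.2 (half_pos hε))
    filter_upwards [hev] with n hn
    have hle := sum_integral_max_sub_le hX hint hdom (hu0' n).le (half_pos hε).le hn (u n)
    have hi : ∀ k, Integrable (fun ω => max (X k ω - u n) 0) μ := fun k =>
      ((hint k).sub (integrable_const _)).pos_part
    have hmin : ∀ k ω, min (X k ω) (u n) / (u n : ℝ) =
        (X k ω - max (X k ω - u n) 0) / (u n : ℝ) := by
      intro k ω
      congr 1
      rcases le_total (X k ω) (u n) with h | h
      · rw [min_eq_left h, max_eq_right (by linarith), sub_zero]
      · rw [min_eq_right h, max_eq_left (by linarith)]; ring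
    have hWn : ∫ ω, W n ω ∂μ - (∑ k ∈ Finset.range (u n), ∫ ω, X k ω ∂μ) / (u n : ℝ) =
        -((∑ k ∈ Finset.range (u n), ∫ ω, max (X k ω - u n) 0 ∂μ) / (u n : ℝ)) := by
      simp only [hW, hmin]
      have hd : ∀ k, Integrable
          (fun ω => (X k ω - max (X k ω - u n) 0) / (u n : ℝ)) μ := fun k =>
        ((hint k).sub (hi k)).div_const _
      rw [integral_finsetSum _ fun k _ => hd k]
      simp only [integral_div]
      rw [Finset.sum_congr rfl fun k _ => by rw [integral_sub (hint k) (hi k)],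
        ← Finset.sum_div, Finset.sum_sub_distrib]
      ring
    have hp : 0 ≤ ∑ k ∈ Finset.range (u n), ∫ ω, max (X k ω - u n) 0 ∂μ :=
      Finset.sum_nonneg fun k _ => integral_nonneg fun ω => le_max_right _ _
    rw [Real.dist_eq, sub_zero, hWn, abs_neg, abs_of_nonneg (div_nonneg hp (hu0' n).le),
      div_lt_iff₀ (hu0' n)]
    nlinarith [hu0' n]
  filter_upwards [hWvar, hBC] with ω h1 h2
  have h3 := h1.add hmean
  rw [add_zero] at h3
  refine h3.congr' ?_
  filter_upwards [h2] with n hn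
  simp only [Set.mem_iUnion, Finset.mem_range, not_exists] at hn
  have : W n ω = (∑ k ∈ Finset.range (u n), X k ω) / (u n : ℝ) := by
    rw [Finset.sum_div]
    refine Finset.sum_congr rfl fun k hk => ?_
    rw [min_eq_left (not_lt.1 (hn k (Finset.mem_range.1 hk)))]
  rw [this]
  ring

/-- Strong law of large numbers for nonnegative pairwise independent random variables whose
averaged tails are dominated by an integrable function. -/
lemma ae_tendsto_sub_div_of_nonneg {X : ℕ → Ω → ℝ} (hX : ∀ k, Measurable (X k))
    (hX0 : ∀ k ω, 0 ≤ X k ω) (hindep : Pairwise fun i j => IndepFun (X i) (X j) μ)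
    (hint : ∀ k, Integrable (X k) μ) {G : ℝ → ℝ≥0∞} (hG : Measurable G)
    (hGint : ∫⁻ x in Set.Ioi 0, G x ≠ ∞)
    (hdom : ∀ (n : ℕ) (x : ℝ), 0 ≤ x → ∑ k ∈ Finset.range n, μ {ω | x < X k ω} ≤ n * G x) :
    ∀ᵐ ω ∂μ, Tendsto (fun n : ℕ => (∑ k ∈ Finset.range n, X k ω -
      ∑ k ∈ Finset.range n, ∫ ω', X k ω' ∂μ) / (n : ℝ)) atTop (nhds 0) := by
  obtain ⟨c, -, hc, hclim⟩ := exists_seq_strictAnti_tendsto (1 : ℝ)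
  have hE0 : ∀ k, 0 ≤ ∫ ω', X k ω' ∂μ := fun k => integral_nonneg (hX0 k)
  have hall := ae_all_iff.2 fun j : ℕ =>
    ae_tendsto_sub_div_floor_pow hX hX0 hindep hint hG hGint hdom (hc j)
  filter_upwards [hall] with ω hω
  refine tendsto_sub_div_of_monotone_of_exists_subseq
    (s := fun n => ∑ k ∈ Finset.range n, X k ω)
    (e := fun n => ∑ k ∈ Finset.range n, ∫ ω', X k ω' ∂μ)
    (monotone_nat_of_le_succ fun n => by
      rw [Finset.sum_range_succ]; linarith [hX0 n ω])
    (monotone_nat_of_le_succ fun n => by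
      rw [Finset.sum_range_succ]; linarith [hE0 n]) ?_ ?_
  · intro ε hε
    obtain ⟨M, hM⟩ := ((tendsto_setLIntegral_Ioi_natCast hG hGint).eventually_le_const
      (ENNReal.ofReal_pos.2 hε)).exists
    refine ⟨M, M.cast_nonneg, fun m n hmn => ?_⟩
    have hi : ∀ k, Integrable (fun ω => max (X k ω - M) 0) μ := fun k =>
      ((hint k).sub (integrable_const _)).pos_part
    have hle := sum_integral_max_sub_le hX hint hdom M.cast_nonneg hε.le hM n
    have hp : ∀ k, 0 ≤ ∫ ω', max (X k ω' - M) 0 ∂μ := fun k =>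
      integral_nonneg fun ω' => le_max_right _ _
    have hk : ∀ k, ∫ ω', X k ω' ∂μ ≤ M + ∫ ω', max (X k ω' - M) 0 ∂μ := fun k => by
      have h1 : ∫ ω', (X k ω' - M) ∂μ ≤ ∫ ω', max (X k ω' - M) 0 ∂μ :=
        integral_mono ((hint k).sub (integrable_const _)) (hi k) fun ω' => le_max_left _ _
      rw [integral_sub (hint k) (integrable_const _), integral_const, probReal_univ,
        one_smul] at h1
      linarith
    rw [← Finset.sum_Ico_eq_sub _ hmn]
    calc ∑ k ∈ Finset.Ico m n, ∫ ω', X k ω' ∂μ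
        ≤ ∑ k ∈ Finset.Ico m n, (M + ∫ ω', max (X k ω' - M) 0 ∂μ) :=
          Finset.sum_le_sum fun k _ => hk k
      _ = M * ((n : ℝ) - m) + ∑ k ∈ Finset.Ico m n, ∫ ω', max (X k ω' - M) 0 ∂μ := by
          rw [Finset.sum_add_distrib, Finset.sum_const, Nat.card_Ico, nsmul_eq_mul,
            Nat.cast_sub hmn, mul_comm]
      _ ≤ M * ((n : ℝ) - m) + ∑ k ∈ Finset.range n, ∫ ω', max (X k ω' - M) 0 ∂μ := by
          rw [Finset.range_eq_Ico]
          exact add_le_add_right (Finset.sum_le_sum_of_subset_of_nonneg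
            (Finset.Ico_subset_Ico_left m.zero_le) fun k _ _ => hp k) _
      _ ≤ M * ((n : ℝ) - m) + ε * n := by linarith
  · intro a ha
    obtain ⟨j, hj⟩ := ((tendsto_order.1 hclim).2 a ha).exists
    exact ⟨fun n => ⌊c j ^ n⌋₊, eventually_floor_pow_succ_le (hc j) hj,
      tendsto_nat_floor_atTop.comp (tendsto_pow_atTop_atTop_of_one_lt (hc j)), hω j⟩

end StrongLaw

/-- Theorem 2: pairwise independent random variables dominated in the sense
`sup_{n≥1} (1/n) ∑_{k=1}^n P(|X_k| > x) ≤ H x` for a non-increasing integrable function `H`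
on `[0,∞)` satisfy `(S_n - E S_n)/n → 0` a.s. -/
theorem slln_dominated_by_function {Ω : Type*} [MeasurableSpace Ω] (μ : Measure Ω)
    [IsProbabilityMeasure μ]
    (X : ℕ → Ω → ℝ) (hmeas : ∀ n, Measurable (X n))
    (hindep : ∀ i j, i ≠ j → IndepFun (X i) (X j) μ)
    (hint : ∀ n, 1 ≤ n → Integrable (X n) μ)
    (H : ℝ → ℝ) (hH_nonneg : ∀ x ∈ Set.Ici (0 : ℝ), 0 ≤ H x)
    (hH_anti : AntitoneOn H (Set.Ici (0 : ℝ)))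
    (hH_int : IntegrableOn H (Set.Ici (0 : ℝ)) volume)
    (hdom : ∀ x : ℝ, 0 ≤ x →
      (⨆ n, ⨆ (_ : 1 ≤ n), (∑ k ∈ Finset.Icc 1 n, μ {ω | x < |X k ω|}) / (n : ℝ≥0∞))
        ≤ ENNReal.ofReal (H x)) :
    ∀ᵐ ω ∂μ, Tendsto
      (fun n : ℕ => ((∑ k ∈ Finset.Icc 1 n, X k ω)
        - ∫ ω', ∑ k ∈ Finset.Icc 1 n, X k ω' ∂μ) / (n : ℝ))
      atTop (nhds 0) := by
  set G : ℝ → ℝ≥0∞ := fun x =>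
    ⨆ n, ⨆ (_ : 1 ≤ n), (∑ k ∈ Finset.Icc 1 n, μ {ω | x < |X k ω|}) / (n : ℝ≥0∞) with hGdef
  have hG : Measurable G := Antitone.measurable fun x y hxy => by
    refine iSup₂_mono fun n _ => ENNReal.div_le_div_right (Finset.sum_le_sum fun k _ => ?_) _
    exact measure_mono fun ω (h : y < |X k ω|) => hxy.trans_lt h
  have hGint : ∫⁻ x in Set.Ioi 0, G x ≠ ∞ := by
    have hH : IntegrableOn H (Set.Ioi (0 : ℝ)) volume := hH_int.mono_set Set.Ioi_subset_Ici_self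
    refine ne_top_of_le_ne_top hH.lintegral_lt_top.ne ?_
    exact setLIntegral_mono' measurableSet_Ioi fun x hx => hdom x (le_of_lt hx)
  have hshift : ∀ {M : Type _} [AddCommMonoid M] (f : ℕ → M) (n : ℕ),
      ∑ k ∈ Finset.Icc 1 n, f k = ∑ k ∈ Finset.range n, f (k + 1) := by
    intro M _ f n
    rw [Finset.range_eq_Ico, Finset.sum_Ico_add']
    rfl
  have htail : ∀ (n : ℕ) (x : ℝ),
      ∑ k ∈ Finset.range n, μ {ω | x < |X (k + 1) ω|} ≤ n * G x := by
    intro n x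
    rcases Nat.eq_zero_or_pos n with rfl | hn
    · simp
    · rw [← hshift (fun k => μ {ω | x < |X k ω|}), mul_comm]
      refine (ENNReal.div_le_iff (by exact_mod_cast hn.ne') (ENNReal.natCast_ne_top n)).1 ?_
      exact le_iSup₂_of_le n hn le_rfl
  have key : ∀ f : ℝ → ℝ, Measurable f → (∀ y, 0 ≤ f y) → (∀ y, f y ≤ |y|) →
      ∀ᵐ ω ∂μ, Tendsto (fun n : ℕ => (∑ k ∈ Finset.range n, f (X (k + 1) ω) -
        ∑ k ∈ Finset.range n, ∫ ω', f (X (k + 1) ω') ∂μ) / (n : ℝ)) atTop (nhds 0) := by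
    intro f hf hf0 hfle
    refine ae_tendsto_sub_div_of_nonneg (X := fun k ω => f (X (k + 1) ω))
      (fun k => hf.comp (hmeas _)) (fun k ω => hf0 _)
      (fun i j hij => (hindep _ _ (by lia)).comp hf hf) (fun k => ?_) hG hGint fun n x _ => ?_
    · refine (hint (k + 1) (by lia)).mono (hf.comp (hmeas _)).aestronglyMeasurable
        (ae_of_all _ fun ω => ?_)
      rw [Real.norm_of_nonneg (hf0 _)]
      exact hfle _
    · exact (Finset.sum_le_sum fun k _ => measure_mono fun ω
        (h : x < f (X (k + 1) ω)) => h.trans_le (hfle _)).trans (htail n x)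
  filter_upwards [key (fun y => max y 0) (by fun_prop) (fun y => le_max_right _ _)
      (fun y => max_le (le_abs_self y) (abs_nonneg y)),
    key (fun y => max (-y) 0) (by fun_prop) (fun y => le_max_right _ _)
      (fun y => max_le (neg_le_abs y) (abs_nonneg y))] with ω hp hm
  have h := hp.sub hm
  rw [sub_zero] at h
  refine h.congr fun n => ?_
  have hXi : ∀ k, Integrable (X (k + 1)) μ := fun k => hint (k + 1) (by lia)
  have hdecomp : ∀ y : ℝ, y = max y 0 - max (-y) 0 := fun y => by
    rcases le_total 0 y with h | h
    · rw [max_eq_left h, max_eq_right (by linarith), sub_zero]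
    · rw [max_eq_right h, max_eq_left (by linarith)]; ring
  have hE : ∀ k, ∫ ω', X (k + 1) ω' ∂μ =
      ∫ ω', max (X (k + 1) ω') 0 ∂μ - ∫ ω', max (-X (k + 1) ω') 0 ∂μ := fun k => by
    rw [← integral_sub (hXi k).pos_part (hXi k).neg_part]
    exact integral_congr_ae (ae_of_all _ fun ω' => hdecomp _)
  simp_rw [hshift]
  rw [integral_finsetSum _ fun k _ => hXi k, Finset.sum_congr rfl fun k _ => hE k,
    Finset.sum_congr rfl fun k _ => hdecomp (X (k + 1) ω), Finset.sum_sub_distrib,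
    Finset.sum_sub_distrib]
  ring
end
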